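/- (Greenberg) There is a Martin-Löf random Δ⁰₂ set Z such that every computably enumerable set A with A ≤_T Z obeys every benign cost function. -/

import Mathlib

/-! Basic definitions: Cantor space, initial segments, computable approximations,
Martin-Löf randomness, change counting, cost functions, oracle computability. -/

/-- The length-`n` initial segment of `Z : ℕ → Bool`, as a list of booleans. -/
def restr (Z : ℕ → Bool) (n : ℕ) : List Bool := (List.range n).map Z

/-- `σ` is an initial segment of `Z`. -/
def InitSeg (σ : List Bool) (Z : ℕ → Bool) : Prop := σ = restr Z σ.length

/-- `Z` is Martin-Löf random: for every computable sequence of strings with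
finite total measure, only finitely many are initial segments of `Z`. -/
def MLRandom (Z : ℕ → Bool) : Prop :=
  ∀ σ : ℕ → List Bool, Computable σ →
    Summable (fun i => ((1 : ℝ) / 2) ^ (σ i).length) →
    {i | InitSeg (σ i) Z}.Finite

/-- `(Zs s) s∈ℕ` converges pointwise to `Z`. -/
def Approx (Zs : ℕ → ℕ → Bool) (Z : ℕ → Bool) : Prop :=
  ∀ x, ∃ t, ∀ s, t ≤ s → Zs s x = Z x

/-- `Zs` is a computable approximation of `Z`. -/
def CompApprox (Zs : ℕ → ℕ → Bool) (Z : ℕ → Bool) : Prop :=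
  Computable₂ Zs ∧ Approx Zs Z

/-- `Z` is Δ⁰₂: it has a computable approximation. -/
def Delta02 (Z : ℕ → Bool) : Prop := ∃ Zs, CompApprox Zs Z

/-- The set of stages `s ≥ 1` at which the length-`n` initial segment of the
approximation changes. -/
def changeStages (Zs : ℕ → ℕ → Bool) (n : ℕ) : Set ℕ :=
  {s | 1 ≤ s ∧ restr (Zs s) n ≠ restr (Zs (s - 1)) n}

/-- `Z` is a `g`-change set. -/
def GChangeSet (Z : ℕ → Bool) (g : ℕ → ℕ) : Prop :=
  ∃ Zs, CompApprox Zs Z ∧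
    ∀ n, (changeStages Zs n).Finite ∧ (changeStages Zs n).ncard ≤ g n

/-- `Z` is ω-c.a.: a `g`-change set for some computable `g`. -/
def OmegaCA (Z : ℕ → Bool) : Prop := ∃ g : ℕ → ℕ, Computable g ∧ GChangeSet Z g

/-- Lexicographic order on Cantor space. -/
def LexLE (X Y : ℕ → Bool) : Prop :=
  X = Y ∨ ∃ n, (∀ i, i < n → X i = Y i) ∧ X n = false ∧ Y n = true

/-- `Z` is left-c.e. -/
def LeftCE (Z : ℕ → Bool) : Prop :=
  ∃ Zs, CompApprox Zs Z ∧ ∀ s, LexLE (Zs s) (Zs (s + 1))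

/-- `c` is a cost function: computable, nonnegative, nondecreasing in the stage,
nonincreasing in the number. -/
def CostFunction (c : ℕ → ℕ → ℚ) : Prop :=
  Computable₂ c ∧ (∀ x s, 0 ≤ c x s) ∧
    (∀ x s t, s ≤ t → c x s ≤ c x t) ∧ (∀ x y s, x ≤ y → c y s ≤ c x s)

/-- The limit condition for a cost function. -/
def LimitCondition (c : ℕ → ℕ → ℚ) : Prop :=
  ∀ ε : ℚ, 0 < ε → ∃ x₀, ∀ x, x₀ ≤ x → ∀ s, c x s ≤ ε

/-- A benign cost function: the number of pairwise disjoint intervals `[x,s)` with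
`c x s ≥ 2^{-k}` is computably bounded in `k`. -/
def Benign (c : ℕ → ℕ → ℚ) : Prop :=
  ∃ b : ℕ → ℕ, Computable b ∧
    ∀ k m (x s : ℕ → ℕ), (∀ i, i < m → x i < s i) →
      (∀ i, i + 1 < m → s i ≤ x (i + 1)) →
      (∀ i, i < m → ((1 : ℚ) / 2) ^ k ≤ c (x i) (s i)) → m ≤ b k

open Classical in
/-- The cost paid at stage `s` by the approximation `As`: if `s ≥ 1` and the
approximation changes at `s`, it is `c x s` where `x` is the least changed number. -/
noncomputable def stageCost (c : ℕ → ℕ → ℚ) (As : ℕ → ℕ → Bool) (s : ℕ) : ℚ :=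
  if s = 0 then 0
  else if h : ∃ x, As s x ≠ As (s - 1) x then c (Nat.find h) s else 0

/-- `A` obeys the cost function `c`: some computable approximation of `A` has
finite total cost. -/
def Obeys (A : ℕ → Bool) (c : ℕ → ℕ → ℚ) : Prop :=
  ∃ As, CompApprox As A ∧ ∃ B : ℚ, ∀ F : Finset ℕ, ∑ s ∈ F, stageCost c As s ≤ B

/-- Functions partial recursive in the oracle `O`. -/
inductive RecIn (O : ℕ →. ℕ) : (ℕ →. ℕ) → Prop
  | oracle : RecIn O O
  | zero : RecIn O (pure 0)
  | succ : RecIn O ↑Nat.succ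
  | left : RecIn O ↑fun n : ℕ => n.unpair.1
  | right : RecIn O ↑fun n : ℕ => n.unpair.2
  | pair {f g} : RecIn O f → RecIn O g → RecIn O fun n => Nat.pair <$> f n <*> g n
  | comp {f g} : RecIn O f → RecIn O g → RecIn O fun n => g n >>= f
  | prec {f g} : RecIn O f → RecIn O g → RecIn O (Nat.unpaired fun a n =>
      n.rec (f a) fun y IH => do let i ← IH; g (Nat.pair a (Nat.pair y i)))
  | rfind {f} : RecIn O f → RecIn O fun a =>
      Nat.rfind fun n => (fun m => m = 0) <$> f (Nat.pair a n)

/-- The characteristic function of `A` as a partial function ℕ →. ℕ. -/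
def charFn (A : ℕ → Bool) : ℕ →. ℕ := fun n => Part.some (cond (A n) 1 0)

/-- Turing reducibility: `A ≤_T Z`. -/
def TuringLE (A Z : ℕ → Bool) : Prop := RecIn (charFn Z) (charFn A)

/-- `A` is computably enumerable: the domain of a partial computable function. -/
def CE (A : ℕ → Bool) : Prop :=
  ∃ f : ℕ →. ℕ, Nat.Partrec f ∧ ∀ x, A x = true ↔ (f x).Dom

/-- A Π⁰₁ class of elements of Cantor space. -/
def Pi01 (P : Set (ℕ → Bool)) : Prop :=
  ∃ f : ℕ → Option (List Bool), Computable f ∧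
    P = {Z | ∀ i σ, f i = some σ → ¬ InitSeg σ Z}

/-- The c.e. set `W_e`: the domain of the `e`-th partial computable function. -/
def Wset (e : ℕ) : Set ℕ :=
  {x | ((Denumerable.ofNat Nat.Partrec.Code e).eval x).Dom}

/-- The stage-`s` approximation to `W_e`, via step-bounded evaluation. -/
def WAt (e s x : ℕ) : Prop :=
  (Nat.Partrec.Code.evaln s (Denumerable.ofNat Nat.Partrec.Code e) x).isSome

/-- `A` is promptly simple. -/
def PromptlySimple (A : ℕ → Bool) : Prop :=
  CE A ∧ {x | A x = false}.Infinite ∧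
    ∃ As : ℕ → ℕ → Bool, Computable₂ As ∧
      (∀ s x, As s x = true → As (s + 1) x = true) ∧
      (∀ x, A x = true ↔ ∃ s, As s x = true) ∧
      ∀ e, (Wset e).Infinite →
        ∃ s x, 1 ≤ s ∧ WAt e s x ∧ ¬ WAt e (s - 1) x ∧ As s x = true
section GreenbergHelpers
open Encodable

def encQ (q : ℚ) : ℕ := @encode ℚ Rat.instEncodable q

theorem encQ_eq (q : ℚ) : encQ q = Nat.pair (encode q.num) q.den := rfl

def RQ (m : ℕ) : Prop := 0 < m.unpair.2 ∧ Nat.Coprime ((Denumerable.ofNat ℤ m.unpair.1).natAbs) m.unpair.2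

instance : DecidablePred RQ := fun _ => by unfold RQ; infer_instance

theorem range_encQ (m : ℕ) : m ∈ Set.range encQ ↔ RQ m := by
  constructor
  · rintro ⟨q, rfl⟩
    rw [encQ_eq, RQ]
    simp only [Nat.unpair_pair, Denumerable.ofNat_encode]
    exact ⟨q.pos, q.reduced⟩
  · rintro ⟨h1, h2⟩
    refine ⟨⟨Denumerable.ofNat ℤ m.unpair.1, m.unpair.2, h1.ne', h2⟩, ?_⟩
    rw [encQ_eq]
    change Nat.pair (encode (Denumerable.ofNat ℤ m.unpair.1)) m.unpair.2 = m
    rw [Denumerable.encode_ofNat, Nat.pair_unpair]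

theorem encode_rat (q : ℚ) : @encode ℚ (Primcodable.toEncodable) q
    = (List.range (encQ q)).countP (fun x => decide (RQ x)) := by
  have h : @encode ℚ (Primcodable.toEncodable) q = (List.range (encQ q)).countP (fun x => @decide (x ∈ Set.range encQ) (@Encodable.decidableRangeEncode ℚ Rat.instEncodable x)) := rfl
  rw [h]
  apply List.countP_congr
  intro x _
  simp [range_encQ, -Set.mem_range]

theorem encQ_mono {q r : ℚ} (h : encQ q < encQ r) : @encode ℚ (Primcodable.toEncodable) q < @encode ℚ (Primcodable.toEncodable) r := by
  rw [encode_rat, encode_rat]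
  have : encQ r = encQ q + 1 + (encQ r - encQ q - 1) := by omega
  rw [this, List.range_add, List.range_succ, List.countP_append, List.countP_append]
  have h2 : RQ (encQ q) := (range_encQ _).1 ⟨q, rfl⟩
  simp [h2]
  omega

/-- comparison on the pair code -/
def cmpQ (m j : ℕ) : Bool := decide (m.unpair.1 % 2 = 0 ∧ m.unpair.2 ≤ m.unpair.1 / 2 * 2 ^ j)

theorem cmpQ_eq (q : ℚ) (j : ℕ) : cmpQ (encQ q) j = decide (((1:ℚ)/2)^j ≤ q) := by
  rw [encQ_eq, cmpQ]
  simp only [Nat.unpair_pair, decide_eq_decide]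
  have hq : q = (q.num : ℚ) / q.den := (Rat.num_div_den q).symm
  have hd : (0:ℚ) < q.den := by exact_mod_cast q.pos
  have key : ((1:ℚ)/2)^j ≤ q ↔ (q.den : ℤ) ≤ q.num * 2^j := by
    conv_lhs => rw [hq]
    rw [le_div_iff₀ hd, div_pow, one_pow, div_mul_eq_mul_div, one_mul, div_le_iff₀ (by positivity)]
    exact_mod_cast Iff.rfl
  rw [key]
  rcases hn : q.num with n | n
  · have : encode (Int.ofNat n) = 2 * n := rfl
    rw [this]
    have e : 2 * n / 2 = n := by omega
    have e2 : (2 * n) % 2 = 0 := by omega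
    rw [e, e2]
    simp only [true_and, Int.ofNat_eq_natCast]
    exact_mod_cast Iff.rfl
  · have : encode (Int.negSucc n) = 2 * n + 1 := rfl
    rw [this]
    have := q.pos
    constructor
    · intro h; omega
    · intro h
      exfalso
      have h1 : Int.negSucc n * 2 ^ j < 0 := mul_neg_of_neg_of_pos (Int.negSucc_lt_zero n) (by positivity)
      omega

theorem forall_lt_gen {α : Type*} [Primcodable α] {R : ℕ → α → Prop} (h : PrimrecRel R) :
    PrimrecRel fun (n : ℕ) (y : α) => ∀ x < n, R x y :=
  (h.forall_mem_list.comp (Primrec.list_range.comp Primrec.fst) Primrec.snd).of_eq (by simp)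

theorem exists_lt_gen {α : Type*} [Primcodable α] {R : ℕ → α → Prop} (h : PrimrecRel R) :
    PrimrecRel fun (n : ℕ) (y : α) => ∃ x < n, R x y :=
  (h.exists_mem_list.comp (Primrec.list_range.comp Primrec.fst) Primrec.snd).of_eq (by simp)

theorem primrec_RQ : PrimrecPred RQ := by
  have hn : Primrec (fun m : ℕ => (Denumerable.ofNat ℤ m).natAbs) := by
    have : Primrec (fun m : ℕ => if m % 2 = 0 then m / 2 else m / 2 + 1) :=
      Primrec.ite (Primrec.eq.comp (Primrec.nat_mod.comp Primrec.id (Primrec.const 2)) (Primrec.const 0))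
        (Primrec.nat_div.comp Primrec.id (Primrec.const 2))
        (Primrec.succ.comp (Primrec.nat_div.comp Primrec.id (Primrec.const 2)))
    refine this.of_eq ?_
    intro m
    obtain ⟨z, rfl⟩ : ∃ z : ℤ, m = encode z := ⟨Denumerable.ofNat ℤ m, (Denumerable.encode_ofNat m).symm⟩
    rw [Denumerable.ofNat_encode]
    rcases z with n | n
    · have : encode (Int.ofNat n) = 2 * n := rfl
      rw [this]; simp
    · have : encode (Int.negSucc n) = 2 * n + 1 := rfl
      rw [this]; simp; omega
  have hc : PrimrecRel (fun a b : ℕ => ∀ d < a + b + 1, a % d = 0 → b % d = 0 → d = 1 ∨ d = 0) := by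
    have h1 : PrimrecRel (fun (d : ℕ) (ab : ℕ × ℕ) => (¬ (ab.1 % d = 0)) ∨ (¬ (ab.2 % d = 0)) ∨ d = 1 ∨ d = 0) := by
      have e0 : ∀ n, PrimrecPred (fun x : ℕ × ℕ × ℕ => x.1 = n) := fun n => Primrec.eq.comp Primrec.fst (Primrec.const n)
      refine PrimrecPred.or (PrimrecPred.not ?_) (PrimrecPred.or (PrimrecPred.not ?_) (PrimrecPred.or (e0 1) (e0 0)))
      · exact Primrec.eq.comp (Primrec.nat_mod.comp (Primrec.fst.comp Primrec.snd) Primrec.fst) (Primrec.const 0)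
      · exact Primrec.eq.comp (Primrec.nat_mod.comp (Primrec.snd.comp Primrec.snd) Primrec.fst) (Primrec.const 0)
    have h1' := forall_lt_gen h1
    have h2 : PrimrecPred (fun ab : ℕ × ℕ => _) := h1'.comp (Primrec.succ.comp (Primrec.nat_add.comp Primrec.fst Primrec.snd)) (Primrec.id : Primrec (id : ℕ × ℕ → ℕ × ℕ))
    refine PrimrecPred.of_eq h2 ?_
    rintro ⟨a, b⟩
    simp only [id, Nat.succ_eq_add_one]
    refine forall_congr' fun d => forall_congr' fun _ => ?_
    tauto
  have := PrimrecPred.and (Primrec.nat_lt.comp (Primrec.const 0) (Primrec.snd.comp Primrec.unpair))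
    (hc.comp (hn.comp (Primrec.fst.comp Primrec.unpair)) (Primrec.snd.comp Primrec.unpair))
  refine PrimrecPred.of_eq this ?_
  intro m
  unfold RQ
  refine and_congr_right fun hpos => ?_
  constructor
  · intro h
    have hg := h (Nat.gcd (Denumerable.ofNat ℤ m.unpair.1).natAbs m.unpair.2)
      (by have := Nat.gcd_le_right (Denumerable.ofNat ℤ m.unpair.1).natAbs hpos; omega)
      (Nat.mod_eq_zero_of_dvd (Nat.gcd_dvd_left _ _)) (Nat.mod_eq_zero_of_dvd (Nat.gcd_dvd_right _ _))
    rcases hg with hg | hg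
    · exact hg
    · have := Nat.gcd_pos_of_pos_right (Denumerable.ofNat ℤ m.unpair.1).natAbs hpos
      omega
  · intro h d _ h1 h2
    left
    exact Nat.eq_one_of_dvd_coprimes h (Nat.dvd_of_mod_eq_zero h1) (Nat.dvd_of_mod_eq_zero h2)

theorem computable_E {α : Type*} [Primcodable α] (E : α → ℕ) (h0 : ∀ a, RQ (E a))
    (hh : ∀ a, encode a = (List.range (E a)).countP (fun x => decide (RQ x)))
    (hm : ∀ a m, m < E a → RQ m → ¬ (List.range m).countP (fun x => decide (RQ x)) = encode a) :
    Computable E := by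
  have h1 : Primrec (fun m : ℕ => (List.range m).countP (fun x => decide (RQ x))) := by
    refine (Primrec.list_length.comp ((Primrec.listFilter primrec_RQ).comp Primrec.list_range)).of_eq ?_
    intro m
    rw [List.countP_eq_length_filter]
  have h2 : PrimrecPred (fun x : ℕ × ℕ => RQ x.2 ∧ (List.range x.2).countP (fun x => decide (RQ x)) = x.1) :=
    PrimrecPred.and (primrec_RQ.comp Primrec.snd) (Primrec.eq.comp (h1.comp Primrec.snd) Primrec.fst)
  have h2' : Computable (fun x : ℕ × ℕ => decide (RQ x.2 ∧ (List.range x.2).countP (fun x => decide (RQ x)) = x.1)) := h2.decide.to_comp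
  have he : Computable (fun x : α × ℕ => ((encode x.1, x.2) : ℕ × ℕ)) :=
    Computable.pair (Computable.encode.comp Computable.fst) Computable.snd
  have h3 : Computable₂ (fun (q : α) (m : ℕ) => decide (RQ m ∧ (List.range m).countP (fun x => decide (RQ x)) = encode q)) :=
    let h3 := Computable.comp h2' he
    h3
  refine (Partrec.rfind h3.partrec₂).of_eq_tot ?_
  intro q
  rw [Nat.mem_rfind]
  refine ⟨?_, ?_⟩
  · refine Part.mem_some_iff.2 (Eq.symm ?_)
    rw [decide_eq_true_iff]
    exact ⟨h0 q, (hh q).symm⟩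
  · intro m hlt
    refine Part.mem_some_iff.2 (Eq.symm ?_)
    rw [decide_eq_false_iff_not]
    rintro ⟨hR, hc⟩
    exact hm q m hlt hR hc

theorem primrec_pow : Primrec₂ ((· ^ ·) : ℕ → ℕ → ℕ) := Primrec₂.unpaired'.1 Nat.Primrec.pow

theorem computable_cmpE {α : Type*} [Primcodable α] (E : α → ℕ) (hE : Computable E) :
    Computable₂ (fun (q : α) (j : ℕ) => cmpQ (E q) j) := by
  have h : PrimrecPred (fun x : ℕ × ℕ => x.1.unpair.1 % 2 = 0 ∧ x.1.unpair.2 ≤ x.1.unpair.1 / 2 * 2 ^ x.2) := by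
    have u1 : Primrec (fun x : ℕ × ℕ => x.1.unpair.1) := Primrec.fst.comp (Primrec.unpair.comp Primrec.fst)
    have u2 : Primrec (fun x : ℕ × ℕ => x.1.unpair.2) := Primrec.snd.comp (Primrec.unpair.comp Primrec.fst)
    refine PrimrecPred.and (Primrec.eq.comp (Primrec.nat_mod.comp u1 (Primrec.const 2)) (Primrec.const 0)) ?_
    exact Primrec.nat_le.comp u2 (Primrec.nat_mul.comp (Primrec.nat_div.comp u1 (Primrec.const 2))
      (primrec_pow.comp (Primrec.const 2) Primrec.snd))
  have h' : Computable (fun x : ℕ × ℕ => cmpQ x.1 x.2) := h.decide.to_comp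
  have he : Computable (fun x : α × ℕ => ((E x.1, x.2) : ℕ × ℕ)) :=
    Computable.pair (hE.comp Computable.fst) Computable.snd
  have h3 := Computable.comp h' he
  exact h3

theorem computable_encQ : Computable encQ := by
  refine computable_E encQ (fun q => (range_encQ _).1 ⟨q, rfl⟩) encode_rat ?_
  intro q m hlt hR hc
  obtain ⟨r, rfl⟩ := (range_encQ _).2 hR
  have := encQ_mono hlt
  rw [← encode_rat] at hc
  omega

/-- Computable comparison of a rational-valued computable function with `2^{-j}`. -/
theorem computable_cmp {α : Type*} [Primcodable α] (f : α → ℚ) (j : α → ℕ) (hf : Computable f)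
    (hj : Computable j) : Computable (fun x => decide (((1:ℚ)/2)^(j x) ≤ f x)) := by
  have h1 : Computable (fun x => encQ (f x)) := computable_encQ.comp hf
  exact ((computable_cmpE _ h1).comp Computable.id hj).of_eq (fun x => cmpQ_eq (f x) (j x))

theorem restr_isPre (Z : ℕ → Bool) {m n : ℕ} (h : m ≤ n) : restr Z m <+: restr Z n := by
  obtain ⟨k, rfl⟩ := Nat.exists_eq_add_of_le h
  unfold restr
  rw [List.range_add, List.map_append]
  exact List.prefix_append _ _

theorem length_restr (Z : ℕ → Bool) (n : ℕ) : (restr Z n).length = n := by simp [restr]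

theorem recIn_uniform (Z : ℕ → Bool) (h : ℕ →. ℕ) (hh : RecIn (charFn Z) h) :
    ∃ F : List Bool → ℕ →. ℕ, Partrec₂ F ∧
      (∀ σ τ x y, σ <+: τ → y ∈ F σ x → y ∈ F τ x) ∧
      ∀ x y, y ∈ h x → ∃ n, y ∈ F (restr Z n) x := by
  induction hh with
  | oracle =>
    refine ⟨fun σ x => ((σ[x]?).map (fun b => cond b 1 0) : Option ℕ), ?_, ?_, ?_⟩
    · apply Computable.ofOption
      apply Computable.option_map
      · exact Computable.list_getElem?.comp Computable.fst Computable.snd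
      · exact (Computable.cond (Computable.snd) (Computable.const 1) (Computable.const 0))
    · intro σ τ x y hp hy
      simp only [Part.mem_ofOption, Option.mem_def, Option.map_eq_some_iff] at hy ⊢
      obtain ⟨b, hb, rfl⟩ := hy
      refine ⟨b, ?_, rfl⟩
      obtain ⟨ρ, rfl⟩ := hp
      rw [List.getElem?_append_left]
      · exact hb
      · exact (List.getElem?_eq_some_iff.1 hb).1
    · intro x y hy
      refine ⟨x+1, ?_⟩
      have hy' : y = cond (Z x) 1 0 := by simpa [charFn] using hy
      simp only [Part.mem_ofOption, Option.mem_def, Option.map_eq_some_iff]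
      refine ⟨Z x, ?_, hy'.symm⟩
      simp [restr]
  | zero =>
    refine ⟨fun _ => pure 0, ?_, fun _ _ _ _ _ h => h, fun x y hy => ⟨0, hy⟩⟩
    exact (Computable.const 0).partrec
  | succ =>
    refine ⟨fun _ => (Nat.succ : ℕ → ℕ), ?_, fun _ _ _ _ _ h => h, fun x y hy => ⟨0, hy⟩⟩
    exact (Computable.succ.comp Computable.snd).partrec
  | left =>
    refine ⟨fun _ => (fun n : ℕ => n.unpair.1 : ℕ → ℕ), ?_, fun _ _ _ _ _ h => h, fun x y hy => ⟨0, hy⟩⟩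
    exact (Computable.fst.comp (Computable.unpair.comp Computable.snd)).partrec
  | right =>
    refine ⟨fun _ => (fun n : ℕ => n.unpair.2 : ℕ → ℕ), ?_, fun _ _ _ _ _ h => h, fun x y hy => ⟨0, hy⟩⟩
    exact (Computable.snd.comp (Computable.unpair.comp Computable.snd)).partrec
  | @pair f g _ _ ihf ihg =>
    obtain ⟨F, hF1, hF2, hF3⟩ := ihf
    obtain ⟨G, hG1, hG2, hG3⟩ := ihg
    refine ⟨fun σ n => (F σ n).bind fun a => (G σ n).map fun b => Nat.pair a b, ?_, ?_, ?_⟩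
    · refine Partrec.bind hF1 (Partrec.map (hG1.comp (Computable.fst.comp Computable.fst) (Computable.snd.comp Computable.fst)) ?_)
      exact Primrec.to_comp (Primrec₂.natPair.comp (Primrec.snd.comp Primrec.fst) Primrec.snd)
    · intro σ τ x y hp hy
      simp only [Part.mem_bind_iff, Part.mem_map_iff] at hy ⊢
      obtain ⟨a, ha, b, hb, rfl⟩ := hy
      exact ⟨a, hF2 _ _ _ _ hp ha, b, hG2 _ _ _ _ hp hb, rfl⟩
    · intro x y hy
      have : ∃ a ∈ f x, ∃ b ∈ g x, Nat.pair a b = y := by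
        simpa [Seq.seq] using hy
      obtain ⟨a, ha, b, hb, rfl⟩ := this
      obtain ⟨m, hm⟩ := hF3 _ _ ha
      obtain ⟨n, hn⟩ := hG3 _ _ hb
      refine ⟨max m n, ?_⟩
      simp only [Part.mem_bind_iff, Part.mem_map_iff]
      exact ⟨a, hF2 _ _ _ _ (restr_isPre Z (le_max_left _ _)) hm, b, hG2 _ _ _ _ (restr_isPre Z (le_max_right _ _)) hn, rfl⟩
  | @comp f g _ _ ihf ihg =>
    obtain ⟨F, hF1, hF2, hF3⟩ := ihf
    obtain ⟨G, hG1, hG2, hG3⟩ := ihg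
    refine ⟨fun σ n => (G σ n).bind (F σ), ?_, ?_, ?_⟩
    · exact Partrec.bind hG1 (hF1.comp (Computable.fst.comp Computable.fst) Computable.snd)
    · intro σ τ x y hp hy
      obtain ⟨a, ha, hb⟩ := Part.mem_bind_iff.1 hy
      exact Part.mem_bind_iff.2 ⟨a, hG2 _ _ _ _ hp ha, hF2 _ _ _ _ hp hb⟩
    · intro x y hy
      have : ∃ a ∈ g x, y ∈ f a := Part.mem_bind_iff.1 hy
      obtain ⟨a, ha, hb⟩ := this
      obtain ⟨m, hm⟩ := hF3 _ _ hb
      obtain ⟨n, hn⟩ := hG3 _ _ ha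
      refine ⟨max m n, ?_⟩
      exact Part.mem_bind_iff.2 ⟨a, hG2 _ _ _ _ (restr_isPre Z (le_max_right _ _)) hn, hF2 _ _ _ _ (restr_isPre Z (le_max_left _ _)) hm⟩
  | @prec f g _ _ ihf ihg =>
    obtain ⟨F, hF1, hF2, hF3⟩ := ihf
    obtain ⟨G, hG1, hG2, hG3⟩ := ihg
    have hmono : ∀ (σ τ : List Bool) (a n y : ℕ), σ <+: τ →
        y ∈ (Nat.rec (F σ a) (fun y IH => IH.bind fun i => G σ (Nat.pair a (Nat.pair y i))) n : Part ℕ) →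
        y ∈ (Nat.rec (F τ a) (fun y IH => IH.bind fun i => G τ (Nat.pair a (Nat.pair y i))) n : Part ℕ) := by
      intro σ τ a n y hp
      induction n generalizing y with
      | zero => exact hF2 _ _ _ _ hp
      | succ n ih =>
        intro h
        obtain ⟨i, ha, hb⟩ := Part.mem_bind_iff.1 h
        exact Part.mem_bind_iff.2 ⟨i, ih _ ha, hG2 _ _ _ _ hp hb⟩
    refine ⟨fun σ n => n.unpair.2.rec (F σ n.unpair.1) fun y IH => IH.bind fun i => G σ (Nat.pair n.unpair.1 (Nat.pair y i)), ?_, ?_, ?_⟩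
    · have h2 : Computable (fun x : List Bool × ℕ => x.2.unpair.2) :=
        Computable.snd.comp (Computable.unpair.comp Computable.snd)
      have h1 : Computable (fun x : List Bool × ℕ => x.2.unpair.1) :=
        Computable.fst.comp (Computable.unpair.comp Computable.snd)
      have hF : Partrec (fun x : List Bool × ℕ => F x.1 x.2.unpair.1) := hF1.comp Computable.fst h1
      have hG : Partrec₂ (fun (x : List Bool × ℕ) (yi : ℕ × ℕ) => G x.1 (Nat.pair x.2.unpair.1 (Nat.pair yi.1 yi.2))) := by
        refine hG1.comp (Computable.fst.comp Computable.fst) ?_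
        refine Primrec.to_comp (Primrec₂.natPair.comp ?_ ?_)
        · exact Primrec.fst.comp (Primrec.unpair.comp (Primrec.snd.comp Primrec.fst))
        · exact Primrec₂.natPair.comp (Primrec.fst.comp Primrec.snd) (Primrec.snd.comp Primrec.snd)
      exact Partrec.nat_rec h2 hF hG
    · intro σ τ x y hp hy
      revert hy
      exact hmono σ τ x.unpair.1 x.unpair.2 y hp
    · intro x y hy
      have key : ∀ n y, y ∈ (Nat.rec (f x.unpair.1) (fun y IH => IH.bind fun i => g (Nat.pair x.unpair.1 (Nat.pair y i))) n : Part ℕ) →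
          ∃ m, y ∈ (Nat.rec (F (restr Z m) x.unpair.1) (fun y IH => IH.bind fun i => G (restr Z m) (Nat.pair x.unpair.1 (Nat.pair y i))) n : Part ℕ) := by
        intro n
        induction n with
        | zero => exact fun y h => hF3 _ _ h
        | succ n ih =>
          intro y hy
          obtain ⟨a, ha, hb⟩ := Part.mem_bind_iff.1 hy
          obtain ⟨m, hm⟩ := ih _ ha
          obtain ⟨k, hk⟩ := hG3 _ _ hb
          refine ⟨max m k, Part.mem_bind_iff.2 ⟨a, ?_, hG2 _ _ _ _ (restr_isPre Z (le_max_right _ _)) hk⟩⟩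
          exact hmono _ _ _ _ _ (restr_isPre Z (le_max_left m k)) hm
      exact key _ _ hy
  | @rfind f _ ihf =>
    obtain ⟨F, hF1, hF2, hF3⟩ := ihf
    refine ⟨fun σ a => Nat.rfind fun n => (F σ (Nat.pair a n)).map fun m => decide (m = 0), ?_, ?_, ?_⟩
    · have : Partrec₂ (fun (x : List Bool × ℕ) (n : ℕ) => (F x.1 (Nat.pair x.2 n)).map fun m => decide (m = 0)) := by
        refine Partrec.map (hF1.comp (Computable.fst.comp Computable.fst) ?_) ?_
        · exact Primrec.to_comp (Primrec₂.natPair.comp (Primrec.snd.comp Primrec.fst) Primrec.snd)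
        · have : PrimrecPred (fun x : ((List Bool × ℕ) × ℕ) × ℕ => x.2 = 0) := Primrec.eq.comp Primrec.snd (Primrec.const 0)
          exact this.decide.to_comp
      exact Partrec.rfind this
    · intro σ τ x y hp hy
      replace hy := Nat.mem_rfind.1 hy
      refine Nat.mem_rfind.2 ⟨?_, fun {m} hm => ?_⟩
      · have := hy.1
        obtain ⟨a, ha, hb⟩ := (Part.mem_map_iff _).1 this
        exact (Part.mem_map_iff _).2 ⟨a, hF2 _ _ _ _ hp ha, hb⟩
      · have := hy.2 hm
        obtain ⟨a, ha, hb⟩ := (Part.mem_map_iff _).1 this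
        exact (Part.mem_map_iff _).2 ⟨a, hF2 _ _ _ _ hp ha, hb⟩
    · intro x y hy
      replace hy := Nat.mem_rfind.1 hy
      have h0 : ∃ a ∈ f (Nat.pair x y), decide (a = 0) = true := by
        exact (Part.mem_map_iff _).1 hy.1
      have h1 : ∀ m < y, ∃ a ∈ f (Nat.pair x m), decide (a = 0) = false := by
        intro m hm
        exact (Part.mem_map_iff _).1 (hy.2 hm)
      have h2 : ∀ k ≤ y, ∃ n, ∀ m < k, ∃ a ∈ F (restr Z n) (Nat.pair x m), decide (a = 0) = false := by
        intro k
        induction k with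
        | zero => intro _; exact ⟨0, fun m hm => absurd hm (Nat.not_lt_zero _)⟩
        | succ k ih =>
          intro hk
          obtain ⟨n, hn⟩ := ih (by omega)
          obtain ⟨a, ha, hb⟩ := h1 k (by omega)
          obtain ⟨n', hn'⟩ := hF3 _ _ ha
          refine ⟨max n n', fun m hm => ?_⟩
          rcases Nat.lt_succ_iff_lt_or_eq.1 hm with h | rfl
          · obtain ⟨a, ha, hb⟩ := hn m h
            exact ⟨a, hF2 _ _ _ _ (restr_isPre Z (le_max_left _ _)) ha, hb⟩
          · exact ⟨a, hF2 _ _ _ _ (restr_isPre Z (le_max_right _ _)) hn', hb⟩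
      obtain ⟨n, hn⟩ := h2 y le_rfl
      obtain ⟨a, ha, hb⟩ := h0
      obtain ⟨n', hn'⟩ := hF3 _ _ ha
      refine ⟨max n n', ?_⟩
      refine Nat.mem_rfind.2 ⟨?_, fun {m} hm => ?_⟩
      · exact (Part.mem_map_iff _).2 ⟨a, hF2 _ _ _ _ (restr_isPre Z (le_max_right _ _)) hn', hb⟩
      · obtain ⟨a, ha, hb⟩ := hn m hm
        exact (Part.mem_map_iff _).2 ⟨a, hF2 _ _ _ _ (restr_isPre Z (le_max_left _ _)) ha, hb⟩

namespace Grb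
open Nat.Partrec

def ev (s e x : ℕ) : Option ℕ := Code.evaln s (Denumerable.ofNat Code e) x

theorem primrec_ev : Primrec (fun q : (ℕ × ℕ) × ℕ => ev q.1.1 q.1.2 q.2) :=
  Code.primrec_evaln.comp (Primrec.pair (Primrec.pair (Primrec.fst.comp Primrec.fst)
    ((Primrec.ofNat Code).comp (Primrec.snd.comp Primrec.fst))) Primrec.snd)

theorem primrec_ev' {α : Type*} [Primcodable α] {s e x : α → ℕ} (hs : Primrec s) (he : Primrec e)
    (hx : Primrec x) : Primrec (fun a => ev (s a) (e a) (x a)) :=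
  primrec_ev.comp (Primrec.pair (Primrec.pair hs he) hx)

def ca (p : ℕ) : ℕ := p.unpair.1.unpair.1.unpair.1
def cf (p : ℕ) : ℕ := p.unpair.1.unpair.1.unpair.2
def cg (p : ℕ) : ℕ := p.unpair.1.unpair.2.unpair.1
def cb (p : ℕ) : ℕ := p.unpair.1.unpair.2.unpair.2

theorem primrec_ca : Primrec ca := Primrec.fst.comp (Primrec.unpair.comp (Primrec.fst.comp (Primrec.unpair.comp (Primrec.fst.comp Primrec.unpair))))
theorem primrec_cf : Primrec cf := Primrec.snd.comp (Primrec.unpair.comp (Primrec.fst.comp (Primrec.unpair.comp (Primrec.fst.comp Primrec.unpair))))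
theorem primrec_cg : Primrec cg := Primrec.fst.comp (Primrec.unpair.comp (Primrec.snd.comp (Primrec.unpair.comp (Primrec.fst.comp Primrec.unpair))))
theorem primrec_cb : Primrec cb := Primrec.snd.comp (Primrec.unpair.comp (Primrec.snd.comp (Primrec.unpair.comp (Primrec.fst.comp Primrec.unpair))))

def As (a s y : ℕ) : Bool := (ev s a y).isSome

def trig (p s x : ℕ) : Prop := ∃ t < s + 1, x < t ∧ ev s (cg p) (Nat.pair p (Nat.pair x t)) = some 1

theorem primrec_trig : PrimrecPred (fun q : ℕ × ℕ × ℕ => trig q.1 q.2.1 q.2.2) := by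
  have h : PrimrecRel (fun (t : ℕ) (q : ℕ × ℕ × ℕ) => q.2.2 < t ∧ ev q.2.1 (cg q.1) (Nat.pair q.1 (Nat.pair q.2.2 t)) = some 1) := by
    have hp : Primrec (fun z : ℕ × ℕ × ℕ × ℕ => z.2.1) := Primrec.fst.comp Primrec.snd
    have hs : Primrec (fun z : ℕ × ℕ × ℕ × ℕ => z.2.2.1) := Primrec.fst.comp (Primrec.snd.comp Primrec.snd)
    have hx : Primrec (fun z : ℕ × ℕ × ℕ × ℕ => z.2.2.2) := Primrec.snd.comp (Primrec.snd.comp Primrec.snd)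
    refine PrimrecPred.and (Primrec.nat_lt.comp hx Primrec.fst) ?_
    exact Primrec.eq.comp (primrec_ev' hs (primrec_cg.comp hp) (Primrec₂.natPair.comp hp (Primrec₂.natPair.comp hx Primrec.fst))) (Primrec.const (some 1))
  exact (exists_lt_gen h).comp (Primrec.succ.comp (Primrec.fst.comp Primrec.snd)) Primrec.id

open Classical in
noncomputable def X (p : ℕ) : ℕ → ℕ × ℕ
  | 0 => (1, 0)
  | s + 1 => if trig p s (X p s).1 ∧ (X p s).2 < (ev s (cb p) p).getD 0 then (s + 1, (X p s).2 + 1) else X p s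

theorem primrec_X : Primrec₂ X := by
  classical
  have h : PrimrecPred (fun z : ℕ × ℕ × ℕ × ℕ => trig z.1 z.2.1 z.2.2.1 ∧ z.2.2.2 < (ev z.2.1 (cb z.1) z.1).getD 0) := by
    have hp : Primrec (fun z : ℕ × ℕ × ℕ × ℕ => z.1) := Primrec.fst
    have hs : Primrec (fun z : ℕ × ℕ × ℕ × ℕ => z.2.1) := Primrec.fst.comp (Primrec.snd)
    have hx : Primrec (fun z : ℕ × ℕ × ℕ × ℕ => z.2.2.1) := Primrec.fst.comp (Primrec.snd.comp Primrec.snd)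
    have hj : Primrec (fun z : ℕ × ℕ × ℕ × ℕ => z.2.2.2) := Primrec.snd.comp (Primrec.snd.comp Primrec.snd)
    refine PrimrecPred.and (primrec_trig.comp (Primrec.pair hp (Primrec.pair hs hx))) ?_
    exact Primrec.nat_lt.comp hj (Primrec.option_getD.comp (primrec_ev' hs (primrec_cb.comp hp) hp) (Primrec.const 0))
  have hstep : Primrec (fun z : ℕ × ℕ × ℕ × ℕ => if trig z.1 z.2.1 z.2.2.1 ∧ z.2.2.2 < (ev z.2.1 (cb z.1) z.1).getD 0 then (z.2.1 + 1, z.2.2.2 + 1) else z.2.2) := by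
    refine Primrec.ite h ?_ (Primrec.snd.comp Primrec.snd)
    exact Primrec.pair (Primrec.succ.comp (Primrec.fst.comp Primrec.snd)) (Primrec.succ.comp (Primrec.snd.comp (Primrec.snd.comp Primrec.snd)))
  have := Primrec.nat_rec (f := fun _ : ℕ => ((1, 0) : ℕ × ℕ)) (g := fun (p : ℕ) (z : ℕ × ℕ × ℕ) => if trig p z.1 z.2.1 ∧ z.2.2 < (ev z.1 (cb p) p).getD 0 then (z.1 + 1, z.2.2 + 1) else z.2) (Primrec.const _) hstep
  refine this.of_eq ?_
  intro p s
  induction s with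
  | zero => rfl
  | succ s ih =>
    simp only at ih ⊢
    rw [X, ih]

def V (p s : ℕ) (τ : List Bool) : Prop :=
  ∀ y < (X p s).1, ∃ n < τ.length + 1, ev s (cf p) (Nat.pair p (Nat.pair (encode (τ.take n)) y)) = some (As (ca p) s y).toNat

theorem primrec_toNat : Primrec Bool.toNat := Primrec.dom_finite _

theorem primrec_V : PrimrecPred (fun q : (ℕ × ℕ) × List Bool => V q.1.1 q.1.2 q.2) := by
  have h1 : PrimrecRel (fun (n : ℕ) (q : ℕ × ((ℕ × ℕ) × List Bool)) =>
      ev q.2.1.2 (cf q.2.1.1) (Nat.pair q.2.1.1 (Nat.pair (encode (q.2.2.take n)) q.1)) = some (As (ca q.2.1.1) q.2.1.2 q.1).toNat) := by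
    have hp : Primrec (fun z : ℕ × (ℕ × ((ℕ × ℕ) × List Bool)) => z.2.2.1.1) := Primrec.fst.comp (Primrec.fst.comp (Primrec.snd.comp Primrec.snd))
    have hs : Primrec (fun z : ℕ × (ℕ × ((ℕ × ℕ) × List Bool)) => z.2.2.1.2) := Primrec.snd.comp (Primrec.fst.comp (Primrec.snd.comp Primrec.snd))
    have ht : Primrec (fun z : ℕ × (ℕ × ((ℕ × ℕ) × List Bool)) => z.2.2.2) := Primrec.snd.comp (Primrec.snd.comp Primrec.snd)
    have hy : Primrec (fun z : ℕ × (ℕ × ((ℕ × ℕ) × List Bool)) => z.2.1) := Primrec.fst.comp (Primrec.snd)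
    have hn : Primrec (fun z : ℕ × (ℕ × ((ℕ × ℕ) × List Bool)) => z.1) := Primrec.fst
    refine Primrec.eq.comp (primrec_ev' hs (primrec_cf.comp hp) (Primrec₂.natPair.comp hp (Primrec₂.natPair.comp (Primrec.encode.comp (Primrec.list_take.comp hn ht)) hy))) ?_
    exact Primrec.option_some.comp (primrec_toNat.comp (Primrec.option_isSome.comp (primrec_ev' hs (primrec_ca.comp hp) hy)))
  have h2 : PrimrecRel (fun (y : ℕ) (q : (ℕ × ℕ) × List Bool) => ∃ n < q.2.length + 1,
      ev q.1.2 (cf q.1.1) (Nat.pair q.1.1 (Nat.pair (encode (q.2.take n)) y)) = some (As (ca q.1.1) q.1.2 y).toNat) :=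
    (exists_lt_gen h1).comp (Primrec.succ.comp (Primrec.list_length.comp (Primrec.snd.comp Primrec.snd))) Primrec.id
  exact (forall_lt_gen h2).comp (Primrec.fst.comp (primrec_X.comp (Primrec.fst.comp Primrec.fst) (Primrec.snd.comp Primrec.fst))) Primrec.id

def allStr : ℕ → List (List Bool)
  | 0 => [[]]
  | n + 1 => (allStr n).map (fun l => false :: l) ++ (allStr n).map (fun l => true :: l)

theorem primrec_allStr : Primrec allStr := by
  have h : Primrec₂ (fun (_ : ℕ) (L : List (List Bool)) => L.map (fun l => false :: l) ++ L.map (fun l => true :: l)) := by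
    refine Primrec.list_append.comp ?_ ?_
    · exact Primrec.list_map Primrec.snd (Primrec.list_cons.comp (Primrec.const false) Primrec.snd)
    · exact Primrec.list_map Primrec.snd (Primrec.list_cons.comp (Primrec.const true) Primrec.snd)
  refine (Primrec.nat_rec₁ [[]] h).of_eq ?_
  intro n
  induction n with
  | zero => rfl
  | succ n ih => simp only at ih ⊢; rw [ih, allStr]

open Classical in
noncomputable def cnt (p s : ℕ) (σ : List Bool) (n : ℕ) : ℕ :=
  ((allStr n).filter (fun ρ => decide (V p s (σ ++ ρ)))).length

theorem primrec_cnt : Primrec (fun q : ((ℕ × ℕ) × List Bool) × ℕ => cnt q.1.1.1 q.1.1.2 q.1.2 q.2) := by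
  classical
  have h : PrimrecRel (fun (ρ : List Bool) (q : (ℕ × ℕ) × List Bool) => V q.1.1 q.1.2 (q.2 ++ ρ)) :=
    primrec_V.comp (Primrec.pair (Primrec.fst.comp Primrec.snd) (Primrec.list_append.comp (Primrec.snd.comp Primrec.snd) Primrec.fst))
  exact Primrec.list_length.comp ((PrimrecRel.listFilter h).comp (primrec_allStr.comp Primrec.snd) Primrec.fst)

def small (p s : ℕ) : Prop := cnt p s [] s * 4 ^ (p + 2) ≤ 2 ^ s

theorem primrec_small : PrimrecRel small := by
  refine Primrec.nat_le.comp (Primrec.nat_mul.comp ?_ ?_) ?_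
  · exact primrec_cnt.comp (Primrec.pair (Primrec.pair Primrec.id (Primrec.const [])) Primrec.snd)
  · exact primrec_pow.comp (Primrec.const 4) (Primrec.nat_add.comp Primrec.fst (Primrec.const 2))
  · exact primrec_pow.comp (Primrec.const 2) Primrec.snd

open Classical in
noncomputable def rr (p s : ℕ) (σ : List Bool) : ℕ :=
  if small p s then cnt p s σ (s - σ.length) * 2 ^ (2 * σ.length) / 2 ^ (s - σ.length) else 0

theorem primrec_rr : Primrec (fun q : (ℕ × ℕ) × List Bool => rr q.1.1 q.1.2 q.2) := by
  classical
  have hl : Primrec (fun q : (ℕ × ℕ) × List Bool => q.2.length) := Primrec.list_length.comp Primrec.snd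
  have hd : Primrec (fun q : (ℕ × ℕ) × List Bool => q.1.2 - q.2.length) := Primrec.nat_sub.comp (Primrec.snd.comp Primrec.fst) hl
  refine Primrec.ite (primrec_small.comp (Primrec.fst.comp Primrec.fst) (Primrec.snd.comp Primrec.fst)) ?_ (Primrec.const 0)
  refine Primrec.nat_div.comp (Primrec.nat_mul.comp ?_ ?_) ?_
  · exact primrec_cnt.comp (Primrec.pair Primrec.id hd)
  · exact primrec_pow.comp (Primrec.const 2) (Primrec.nat_mul.comp (Primrec.const 2) hl)
  · exact primrec_pow.comp (Primrec.const 2) hd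

noncomputable def RR (s : ℕ) (σ : List Bool) : ℕ := ∑ p ∈ Finset.range σ.length, rr p s σ

theorem primrec_RR : Primrec₂ RR := by
  have hg : Primrec₂ (fun (q : ℕ × List Bool) (z : ℕ × ℕ) => z.2 + rr z.1 q.1 q.2) := by
    refine Primrec.nat_add.comp (Primrec.snd.comp Primrec.snd) ?_
    exact primrec_rr.comp (Primrec.pair (Primrec.pair (Primrec.fst.comp Primrec.snd) (Primrec.fst.comp Primrec.fst)) (Primrec.snd.comp Primrec.fst))
  have := (Primrec.nat_rec (Primrec.const 0) hg).comp (Primrec.id) (Primrec.list_length.comp Primrec.snd)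
  refine this.of_eq ?_
  rintro ⟨s, σ⟩
  simp only [id, RR]
  generalize σ.length = n
  induction n with
  | zero => rfl
  | succ n ih => rw [Finset.sum_range_succ, ← ih]

noncomputable def bit (s : ℕ) (σ : List Bool) : Bool := decide (RR s (σ ++ [true]) < RR s (σ ++ [false]))

theorem primrec_bit : Primrec₂ bit := by
  have : PrimrecPred (fun q : ℕ × List Bool => RR q.1 (q.2 ++ [true]) < RR q.1 (q.2 ++ [false])) := by
    refine Primrec.nat_lt.comp (primrec_RR.comp Primrec.fst ?_) (primrec_RR.comp Primrec.fst ?_)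
    · exact Primrec.list_append.comp Primrec.snd (Primrec.const _)
    · exact Primrec.list_append.comp Primrec.snd (Primrec.const _)
  exact this.decide

noncomputable def Zpre (s : ℕ) : ℕ → List Bool
  | 0 => []
  | n + 1 => Zpre s n ++ [bit s (Zpre s n)]

theorem primrec_Zpre : Primrec₂ Zpre := by
  have hg : Primrec₂ (fun (s : ℕ) (z : ℕ × List Bool) => z.2 ++ [bit s z.2]) := by
    refine Primrec.list_append.comp (Primrec.snd.comp Primrec.snd) ?_
    exact Primrec.list_cons.comp (primrec_bit.comp Primrec.fst (Primrec.snd.comp Primrec.snd)) (Primrec.const [])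
  refine (Primrec.nat_rec (Primrec.const []) hg).of_eq ?_
  intro s n
  induction n with
  | zero => rfl
  | succ n ih => simp only at ih ⊢; rw [ih, Zpre]

noncomputable def Zs (s x : ℕ) : Bool := bit s (Zpre s x)

theorem primrec_Zs : Primrec₂ Zs := primrec_bit.comp Primrec.fst (primrec_Zpre)

end Grb

namespace Grb
open Nat.Partrec

open Classical in
noncomputable def cn (P : List Bool → Prop) (n : ℕ) : ℕ := ((allStr n).filter (fun ρ => decide (P ρ))).length

theorem cn_zero (P : List Bool → Prop) [Decidable (P [])] : cn P 0 = if P [] then 1 else 0 := by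
  unfold cn allStr
  by_cases h : P [] <;> simp [h]

theorem cn_succ (P : List Bool → Prop) (n : ℕ) :
    cn P (n + 1) = cn (fun τ => P (false :: τ)) n + cn (fun τ => P (true :: τ)) n := by
  unfold cn
  rw [allStr, List.filter_append, List.length_append, List.filter_map, List.filter_map, List.length_map, List.length_map]
  rfl

theorem cn_mono {P Q : List Bool → Prop} (n : ℕ) (h : ∀ τ, τ.length = n → P τ → Q τ) : cn P n ≤ cn Q n := by
  classical
  induction n generalizing P Q with
  | zero =>
    rw [cn_zero, cn_zero]
    have := h [] rfl
    split_ifs <;> simp_all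
  | succ n ih =>
    rw [cn_succ, cn_succ]
    exact Nat.add_le_add (ih fun τ hτ => h _ (by simp [hτ])) (ih fun τ hτ => h _ (by simp [hτ]))

theorem cn_true (n : ℕ) : cn (fun _ => True) n = 2 ^ n := by
  induction n with
  | zero => rw [cn_zero]; simp
  | succ n ih => rw [cn_succ, ih]; ring

theorem cn_le (P : List Bool → Prop) (n : ℕ) : cn P n ≤ 2 ^ n := by
  rw [← cn_true]; exact cn_mono n fun _ _ _ => trivial

theorem cn_all {P : List Bool → Prop} (n : ℕ) (h : ∀ τ, P τ) : cn P n = 2 ^ n := by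
  refine le_antisymm (cn_le _ _) ?_
  rw [← cn_true]; exact cn_mono n fun _ _ _ => h _

theorem cn_up {P : List Bool → Prop} (n : ℕ) (h : ∀ τ b, P τ → P (τ ++ [b])) : 2 * cn P n ≤ cn P (n + 1) := by
  classical
  induction n generalizing P with
  | zero =>
    rw [cn_succ, cn_zero, cn_zero, cn_zero]
    have h0 := h [] false
    have h1 := h [] true
    simp only [List.nil_append] at h0 h1
    split_ifs <;> simp_all
  | succ n ih =>
    rw [cn_succ P (n+1), cn_succ P n]
    have h0 := ih (P := fun τ => P (false :: τ)) (fun τ b => h (false :: τ) b)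
    have h1 := ih (P := fun τ => P (true :: τ)) (fun τ b => h (true :: τ) b)
    omega

theorem cn_up_le {P : List Bool → Prop} (h : ∀ τ b, P τ → P (τ ++ [b])) {m n : ℕ} (hmn : m ≤ n) :
    cn P m * 2 ^ (n - m) ≤ cn P n := by
  obtain ⟨k, rfl⟩ := Nat.exists_eq_add_of_le hmn
  rw [Nat.add_sub_cancel_left]
  clear hmn
  induction k with
  | zero => simp
  | succ k ih =>
    have := cn_up (m + k) h
    rw [pow_succ, ← add_assoc]
    nlinarith

theorem cn_disj {ι : Type*} (S : Finset ι) (P : ι → List Bool → Prop) (n : ℕ)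
    (h : ∀ i ∈ S, ∀ j ∈ S, ∀ τ, P i τ → P j τ → i = j) : ∑ i ∈ S, cn (P i) n ≤ 2 ^ n := by
  classical
  induction n generalizing P with
  | zero =>
    simp only [cn_zero, pow_zero]
    rw [Finset.sum_ite, Finset.sum_const_zero, add_zero, Finset.sum_const, smul_eq_mul, mul_one]
    rw [Finset.card_le_one]
    intro a ha b hb
    simp only [Finset.mem_filter] at ha hb
    exact h a ha.1 b hb.1 _ ha.2 hb.2
  | succ n ih =>
    simp only [cn_succ]
    rw [Finset.sum_add_distrib]
    have h0 := ih (fun i τ => P i (false :: τ)) (fun i hi j hj τ => h i hi j hj _)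
    have h1 := ih (fun i τ => P i (true :: τ)) (fun i hi j hj τ => h i hi j hj _)
    rw [pow_succ]; omega

open Classical in
theorem cn_markov {ι : Type*} (S : Finset ι) (P : ι → List Bool → Prop) (n M : ℕ) :
    cn (fun τ => M ≤ (S.filter (fun i => P i τ)).card) n * M ≤ ∑ i ∈ S, cn (P i) n := by
  induction n generalizing P with
  | zero =>
    simp only [cn_zero]
    rw [Finset.sum_ite, Finset.sum_const_zero, add_zero, Finset.sum_const, smul_eq_mul, mul_one]
    split_ifs with h
    · simpa using h
    · simp
  | succ n ih =>
    simp only [cn_succ]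
    rw [Finset.sum_add_distrib, add_mul]
    exact Nat.add_le_add (ih _) (ih _)

theorem cn_isPre (ρ : List Bool) (n : ℕ) : cn (fun τ => ρ <+: τ) n * 2 ^ ρ.length ≤ 2 ^ n := by
  induction ρ generalizing n with
  | nil => simpa using cn_le _ n
  | cons b ρ ih =>
    cases n with
    | zero => rw [cn_zero]; simp
    | succ n =>
      have hz : cn (fun _ : List Bool => False) n = 0 := by unfold cn; simp
      have := ih n
      rw [cn_succ]
      cases b <;> simp [List.cons_prefix_cons, hz, pow_succ] <;> nlinarith

theorem V_up {p s : ℕ} {τ τ' : List Bool} (h : τ <+: τ') (hV : V p s τ) : V p s τ' := by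
  intro y hy
  obtain ⟨n, hn, he⟩ := hV y hy
  refine ⟨n, lt_of_lt_of_le hn (Nat.succ_le_succ h.length_le), ?_⟩
  obtain ⟨ρ, rfl⟩ := h
  rw [List.take_append_of_le_length (by omega)]
  exact he

theorem cnt_eq (p s : ℕ) (σ : List Bool) (n : ℕ) : cnt p s σ n = cn (fun ρ => V p s (σ ++ ρ)) n := rfl

theorem cnt_succ (p s : ℕ) (σ : List Bool) (n : ℕ) :
    cnt p s σ (n + 1) = cnt p s (σ ++ [false]) n + cnt p s (σ ++ [true]) n := by
  simp only [cnt_eq, cn_succ, List.append_assoc, List.singleton_append]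

theorem V_up_app (p s : ℕ) (σ τ : List Bool) (b : Bool) (h : V p s (σ ++ τ)) : V p s (σ ++ (τ ++ [b])) := by
  refine V_up ?_ h
  rw [← List.append_assoc]
  exact List.prefix_append _ _

theorem cnt_up (p s : ℕ) (σ : List Bool) (n : ℕ) : 2 * cnt p s σ n ≤ cnt p s σ (n + 1) :=
  cn_up n (fun τ b h => V_up_app p s σ τ b h)

theorem cnt_le (p s : ℕ) (σ : List Bool) (n : ℕ) : cnt p s σ n ≤ 2 ^ n := cn_le _ _

theorem cnt_le_nil (p s : ℕ) (σ : List Bool) (n : ℕ) : cnt p s σ n ≤ cnt p s [] (σ.length + n) := by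
  induction σ using List.reverseRecOn generalizing n with
  | nil => simp
  | append_singleton σ b ih =>
    have h1 := ih (n + 1)
    have h2 := cnt_succ p s σ n
    rw [List.length_append, List.length_singleton, show σ.length + 1 + n = σ.length + (n + 1) by omega]
    cases b <;> omega

theorem stab (f : ℕ → ℕ) (B t0 : ℕ) (hB : ∀ s, f s ≤ B) (hm : ∀ s, t0 ≤ s → f s ≤ f (s + 1)) :
    ∃ s0, t0 ≤ s0 ∧ ∀ s, s0 ≤ s → f s = f s0 := by
  by_contra hcon
  push Not at hcon
  have hmono : ∀ s t, t0 ≤ s → s ≤ t → f s ≤ f t := by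
    intro s t hs hst
    induction hst with
    | refl => exact le_rfl
    | step h ih => exact ih.trans (hm _ (hs.trans h))
  have : ∀ k, ∃ s, t0 ≤ s ∧ k ≤ f s := by
    intro k
    induction k with
    | zero => exact ⟨t0, le_rfl, Nat.zero_le _⟩
    | succ k ih =>
      obtain ⟨s, hs, hk⟩ := ih
      obtain ⟨t, hst, hne⟩ := hcon s hs
      have := hmono s t hs hst
      exact ⟨t, hs.trans hst, by omega⟩
  obtain ⟨s, _, hs⟩ := this (B + 1)
  have := hB s
  omega

theorem ev_mono {s t e x v : ℕ} (h : s ≤ t) (hv : ev s e x = some v) : ev t e x = some v :=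
  Code.evaln_mono h hv

theorem ev_det {s t e x v w : ℕ} (hv : ev s e x = some v) (hw : ev t e x = some w) : v = w := by
  have h1 := ev_mono (le_max_left s t) hv
  have h2 := ev_mono (le_max_right s t) hw
  rw [h1] at h2
  exact Option.some.inj h2

theorem As_mono {a s t y : ℕ} (h : s ≤ t) (hv : As a s y = true) : As a t y = true := by
  unfold As at *
  obtain ⟨v, hv⟩ := Option.isSome_iff_exists.1 hv
  rw [ev_mono h hv]; rfl

theorem X_bound (p : ℕ) : ∃ B, ∀ s, (X p s).2 ≤ B := by
  have : ∃ B, ∀ s, (ev s (cb p) p).getD 0 ≤ B := by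
    by_cases h : ∃ s v, ev s (cb p) p = some v
    · obtain ⟨s, v, hv⟩ := h
      refine ⟨v, fun t => ?_⟩
      rcases ht : ev t (cb p) p with _ | w
      · simp
      · simp [ev_det hv ht]
    · push Not at h
      refine ⟨0, fun t => ?_⟩
      rcases ht : ev t (cb p) p with _ | w
      · simp
      · exact absurd ht (h t w)
  obtain ⟨B, hB⟩ := this
  refine ⟨B, fun s => ?_⟩
  induction s with
  | zero => simp [X]
  | succ s ih =>
    rw [X]
    split_ifs with h
    · exact h.2.trans_le (hB s)
    · exact ih

theorem X_step (p s : ℕ) : X p (s + 1) = X p s ∨ ((X p s).1 < (X p (s + 1)).1 ∧ (X p (s + 1)).2 = (X p s).2 + 1) := by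
  by_cases h : trig p s (X p s).1 ∧ (X p s).2 < (ev s (cb p) p).getD 0
  · right
    rw [X, if_pos h]
    obtain ⟨⟨t, h1, h2, _⟩, _⟩ := h
    exact ⟨by simp only; omega, rfl⟩
  · left; rw [X, if_neg h]

theorem X_mono (p : ℕ) {s t : ℕ} (h : s ≤ t) : (X p s).1 ≤ (X p t).1 := by
  induction h with
  | refl => exact le_rfl
  | step h ih =>
    rcases X_step p _ with h1 | h1
    · rw [Nat.succ_eq_add_one, h1]; exact ih
    · exact ih.trans h1.1.le

theorem X_conv (p : ℕ) : ∃ s0, ∀ s, s0 ≤ s → X p s = X p s0 := by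
  obtain ⟨B, hB⟩ := X_bound p
  obtain ⟨s0, -, h⟩ := stab (fun s => (X p s).2) B 0 hB (by
    intro s _
    rcases X_step p s with h1 | h1
    · simp only [h1]; exact le_rfl
    · simp only [h1.2]; omega)
  refine ⟨s0, fun s hs => ?_⟩
  induction hs with
  | refl => rfl
  | @step m hm ih =>
    rcases X_step p m with h1 | h1
    · rw [Nat.succ_eq_add_one, h1, ih]
    · have e1 := h m hm
      have e2 := h (m + 1) (Nat.le_succ_of_le hm)
      omega

theorem As_conv (a x : ℕ) : ∃ s0, ∀ s, s0 ≤ s → ∀ y < x, As a s y = As a s0 y := by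
  induction x with
  | zero => exact ⟨0, fun s _ y hy => absurd hy (Nat.not_lt_zero _)⟩
  | succ x ih =>
    obtain ⟨s0, h0⟩ := ih
    by_cases hx : ∃ s, As a s x = true
    · obtain ⟨s1, h1⟩ := hx
      refine ⟨max s0 s1, fun s hs y hy => ?_⟩
      rcases Nat.lt_succ_iff_lt_or_eq.1 hy with h | rfl
      · rw [h0 s (le_trans (le_max_left _ _) hs) y h, h0 _ (le_max_left _ _) y h]
      · rw [As_mono (le_trans (le_max_right _ _) hs) h1, As_mono (le_max_right _ _) h1]
    · push Not at hx
      refine ⟨s0, fun s hs y hy => ?_⟩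
      rcases Nat.lt_succ_iff_lt_or_eq.1 hy with h | rfl
      · exact h0 s hs y h
      · have := hx s
        have := hx s0
        simp_all

theorem V_conv (p : ℕ) : ∃ t0, ∀ s t, t0 ≤ s → s ≤ t → ∀ τ, V p s τ → V p t τ := by
  obtain ⟨s0, h0⟩ := X_conv p
  obtain ⟨s1, h1⟩ := As_conv (ca p) (X p s0).1
  refine ⟨max s0 s1, fun s t hs hst τ hV y hy => ?_⟩
  have hs0 : s0 ≤ s := le_trans (le_max_left _ _) hs
  have hs1 : s1 ≤ s := le_trans (le_max_right _ _) hs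
  rw [h0 t (hs0.trans hst)] at hy
  obtain ⟨n, hn, he⟩ := hV y (by rw [h0 s hs0]; exact hy)
  refine ⟨n, hn, ?_⟩
  rw [h1 t (hs1.trans hst) y hy, ← h1 s hs1 y hy]
  exact ev_mono hst he

theorem small_conv (p : ℕ) : ∃ t0, ∀ s, t0 ≤ s → small p (s + 1) → small p s := by
  obtain ⟨t0, h0⟩ := V_conv p
  refine ⟨t0, fun s hs h => ?_⟩
  unfold small at *
  have h1 := cnt_up p s [] s
  have h2 : cnt p s [] (s + 1) ≤ cnt p (s + 1) [] (s + 1) := cn_mono _ fun τ _ => h0 s (s + 1) hs (Nat.le_succ _) _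
  rw [pow_succ 2 s] at h
  nlinarith [pow_pos (show 0 < 4 by norm_num) (p + 2)]

theorem small_stab (p : ℕ) : ∃ t0, ∀ s, t0 ≤ s → (small p s ↔ small p t0) := by
  obtain ⟨t0, h0⟩ := small_conv p
  by_cases h : ∃ s, t0 ≤ s ∧ ¬ small p s
  · obtain ⟨s, hs, hn⟩ := h
    refine ⟨s, fun t ht => ?_⟩
    have : ¬ small p t := by
      induction ht with
      | refl => exact hn
      | step h1 ih => exact fun h2 => ih (h0 _ (hs.trans h1) h2)
    tauto
  · push Not at h
    exact ⟨t0, fun s hs => ⟨fun _ => h t0 le_rfl, fun _ => h s hs⟩⟩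

theorem rr_conv (p : ℕ) (σ : List Bool) : ∃ s0, ∀ s, s0 ≤ s → rr p s σ = rr p s0 σ := by
  obtain ⟨t0, h0⟩ := V_conv p
  obtain ⟨t1, h1⟩ := small_stab p
  obtain ⟨s0, hs0, h⟩ := stab (fun s => cnt p s σ (s - σ.length) * 2 ^ (2 * σ.length) / 2 ^ (s - σ.length))
    (2 ^ (2 * σ.length)) (max t0 (max t1 σ.length)) (by
      intro s
      refine Nat.div_le_of_le_mul ?_
      exact Nat.mul_le_mul_right _ (cnt_le _ _ _ _)) (by
      intro s hs
      simp only [max_le_iff] at hs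
      have e : s + 1 - σ.length = (s - σ.length) + 1 := by omega
      simp only [e]
      have h1 := cnt_up p s σ (s - σ.length)
      have h2 : cnt p s σ (s - σ.length + 1) ≤ cnt p (s + 1) σ (s - σ.length + 1) :=
        cn_mono _ fun τ _ => h0 s (s + 1) hs.1 (Nat.le_succ _) _
      rw [← Nat.mul_div_mul_right _ (2 ^ (s - σ.length)) (show 0 < 2 by norm_num), ← pow_succ]
      refine Nat.div_le_div_right ?_
      rw [mul_right_comm]
      exact Nat.mul_le_mul_right _ (by omega))
  refine ⟨s0, fun s hs => ?_⟩
  simp only [max_le_iff] at hs0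
  have e : small p s ↔ small p s0 := (h1 s (by omega)).trans (h1 s0 (by omega)).symm
  have := h s hs
  unfold rr
  rw [this]
  by_cases hh : small p s0
  · rw [if_pos hh, if_pos (e.2 hh)]
  · rw [if_neg hh, if_neg (fun h => hh (e.1 h))]

theorem RR_conv (σ : List Bool) : ∃ s0, ∀ s, s0 ≤ s → RR s σ = RR s0 σ := by
  unfold RR
  generalize σ.length = n
  induction n with
  | zero => exact ⟨0, fun _ _ => rfl⟩
  | succ n ih =>
    obtain ⟨s0, h0⟩ := ih
    obtain ⟨s1, h1⟩ := rr_conv n σ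
    refine ⟨max s0 s1, fun s hs => ?_⟩
    rw [Finset.sum_range_succ, Finset.sum_range_succ, h0 s (by omega), h0 (max s0 s1) (by omega), h1 s (by omega), h1 (max s0 s1) (by omega)]

theorem bit_conv (σ : List Bool) : ∃ s0, ∀ s, s0 ≤ s → bit s σ = bit s0 σ := by
  obtain ⟨s0, h0⟩ := RR_conv (σ ++ [true])
  obtain ⟨s1, h1⟩ := RR_conv (σ ++ [false])
  refine ⟨max s0 s1, fun s hs => ?_⟩
  unfold bit
  rw [h0 s (by omega), h0 (max s0 s1) (by omega), h1 s (by omega), h1 (max s0 s1) (by omega)]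

theorem Zpre_conv (n : ℕ) : ∃ s0, ∀ s, s0 ≤ s → Zpre s n = Zpre s0 n := by
  induction n with
  | zero => exact ⟨0, fun _ _ => rfl⟩
  | succ n ih =>
    obtain ⟨s0, h0⟩ := ih
    obtain ⟨s1, h1⟩ := bit_conv (Zpre s0 n)
    refine ⟨max s0 s1, fun s hs => ?_⟩
    rw [Zpre, Zpre, h0 s (by omega), h0 (max s0 s1) (by omega), h1 s (by omega), h1 (max s0 s1) (by omega)]

theorem Zs_conv (x : ℕ) : ∃ b, ∃ s0, ∀ s, s0 ≤ s → Zs s x = b := by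
  obtain ⟨s0, h0⟩ := Zpre_conv x
  obtain ⟨s1, h1⟩ := bit_conv (Zpre s0 x)
  refine ⟨bit s1 (Zpre s0 x), max s0 s1, fun s hs => ?_⟩
  unfold Zs
  rw [h0 s (by omega), h1 s (by omega)]

noncomputable def Z (x : ℕ) : Bool := (Zs_conv x).choose

theorem Z_spec (x : ℕ) : ∃ s0, ∀ s, s0 ≤ s → Zs s x = Z x := (Zs_conv x).choose_spec

theorem restr_succ (Y : ℕ → Bool) (n : ℕ) : restr Y (n + 1) = restr Y n ++ [Y n] := by
  simp [restr, List.range_succ]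

theorem Zpre_lim (n : ℕ) : ∃ s0, ∀ s, s0 ≤ s → Zpre s n = restr Z n := by
  induction n with
  | zero => exact ⟨0, fun _ _ => rfl⟩
  | succ n ih =>
    obtain ⟨s0, h0⟩ := ih
    obtain ⟨s1, h1⟩ := Z_spec n
    refine ⟨max s0 s1, fun s hs => ?_⟩
    have := h1 s (by omega)
    unfold Zs at this
    rw [Zpre, this, h0 s (by omega), restr_succ]

theorem Z_delta : Delta02 Z := ⟨Zs, primrec_Zs.to_comp, Z_spec⟩

theorem length_Zpre (s n : ℕ) : (Zpre s n).length = n := by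
  induction n with
  | zero => rfl
  | succ n ih => simp [Zpre, ih]

open Classical in
noncomputable def dd (p s : ℕ) (σ : List Bool) : ℚ :=
  if small p s then (cnt p s σ (s - σ.length) : ℚ) / 2 ^ (s - σ.length) else 0

theorem dd_nonneg (p s : ℕ) (σ : List Bool) : 0 ≤ dd p s σ := by
  unfold dd; split_ifs <;> positivity

theorem dd_split (p s : ℕ) (σ : List Bool) (h : σ.length < s) :
    dd p s (σ ++ [false]) + dd p s (σ ++ [true]) = 2 * dd p s σ := by
  unfold dd
  split_ifs
  · have e : s - σ.length = (s - (σ.length + 1)) + 1 := by omega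
    simp only [List.length_append, List.length_singleton]
    rw [e, cnt_succ, pow_succ]
    push_cast
    field_simp
  · simp

theorem dd_le (p s : ℕ) (σ : List Bool) (h : σ.length ≤ s) : dd p s σ ≤ 2 ^ σ.length / 4 ^ (p + 2) := by
  unfold dd
  split_ifs with hs
  · unfold small at hs
    have h1 := cnt_le_nil p s σ (s - σ.length)
    have e : σ.length + (s - σ.length) = s := by omega
    rw [e] at h1
    rw [div_le_div_iff₀ (by positivity) (by positivity), ← pow_add, e]
    have : cnt p s σ (s - σ.length) * 4 ^ (p + 2) ≤ 2 ^ s := (Nat.mul_le_mul_right _ h1).trans hs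
    exact_mod_cast this
  · positivity

theorem rr_dd (p s : ℕ) (σ : List Bool) : (rr p s σ : ℚ) ≤ dd p s σ * 2 ^ (2 * σ.length) ∧
    dd p s σ * 2 ^ (2 * σ.length) ≤ rr p s σ + 1 := by
  unfold dd rr
  split_ifs
  · set a := cnt p s σ (s - σ.length)
    set b := 2 ^ (2 * σ.length) with hb
    set c := 2 ^ (s - σ.length) with hc
    have hcpos : 0 < c := by positivity
    have e : (a : ℚ) / 2 ^ (s - σ.length) * 2 ^ (2 * σ.length) = ((a * b : ℕ) : ℚ) / (c : ℕ) := by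
      rw [hb, hc]; push_cast; ring
    rw [e]
    refine ⟨Nat.cast_div_le, ?_⟩
    rw [div_le_iff₀ (by exact_mod_cast hcpos)]
    have := Nat.lt_mul_div_succ (a * b) hcpos
    have h2 : a * b ≤ (a * b / c + 1) * c := by nlinarith
    exact_mod_cast h2
  · simp

theorem RR_le (s : ℕ) (σ : List Bool) (b : Bool) : RR s (σ ++ [bit s σ]) ≤ RR s (σ ++ [b]) := by
  by_cases h : RR s (σ ++ [true]) < RR s (σ ++ [false])
  · have e : bit s σ = true := by simp [bit, h]
    rw [e]; cases b <;> omega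
  · have e : bit s σ = false := by simp [bit, h]
    rw [e]; cases b <;> omega

noncomputable def SS (s : ℕ) (σ : List Bool) : ℚ := ∑ p ∈ Finset.range σ.length, dd p s σ

theorem RR_SS (s : ℕ) (σ : List Bool) : (RR s σ : ℚ) ≤ SS s σ * 2 ^ (2 * σ.length) ∧
    SS s σ * 2 ^ (2 * σ.length) ≤ RR s σ + σ.length := by
  unfold RR SS
  push_cast
  rw [Finset.sum_mul]
  refine ⟨Finset.sum_le_sum fun p _ => (rr_dd p s σ).1, ?_⟩
  have : ∑ p ∈ Finset.range σ.length, ((rr p s σ : ℚ) + 1) = ∑ p ∈ Finset.range σ.length, (rr p s σ : ℚ) + σ.length := by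
    rw [Finset.sum_add_distrib]; simp
  rw [← this]
  exact Finset.sum_le_sum fun p _ => (rr_dd p s σ).2

theorem SS_bound (s n : ℕ) (h : n ≤ s) : SS s (Zpre s n) ≤ 5 / 8 * (1 - 1 / 2 ^ n) := by
  induction n with
  | zero => simp [SS, Zpre]
  | succ n ih =>
    have ih := ih (by omega)
    set σ := Zpre s n with hσ
    have hl : σ.length = n := length_Zpre s n
    have key : ∀ b : Bool, SS s (σ ++ [bit s σ]) ≤ SS s (σ ++ [b]) + (n + 1) / 2 ^ (2 * (n + 1)) := by
      intro b
      have h1 := (RR_SS s (σ ++ [bit s σ])).2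
      have h2 := (RR_SS s (σ ++ [b])).1
      have h3 : (RR s (σ ++ [bit s σ]) : ℚ) ≤ RR s (σ ++ [b]) := by exact_mod_cast RR_le s σ b
      simp only [List.length_append, List.length_singleton, hl] at h1 h2
      have hp : (0 : ℚ) < 2 ^ (2 * (n + 1)) := by positivity
      rw [← sub_le_iff_le_add', le_div_iff₀ hp]
      push_cast at h1
      linarith
    have hsplit : SS s (σ ++ [false]) + SS s (σ ++ [true]) = 2 * (SS s σ + dd n s σ) := by
      unfold SS
      simp only [List.length_append, List.length_singleton, hl]
      rw [← Finset.sum_add_distrib, ← Finset.sum_range_succ, Finset.mul_sum]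
      exact Finset.sum_congr rfl fun p _ => dd_split p s σ (by omega)
    have hd := dd_le n s σ (by omega)
    rw [hl] at hd
    have e1 : (2 : ℚ) ^ n / 4 ^ (n + 2) = 1 / 16 * (1 / 2 ^ n) := by
      rw [show (4 : ℚ) = 2 ^ 2 by norm_num, ← pow_mul]
      rw [show 2 * (n + 2) = n + n + 4 by ring, pow_add, pow_add]
      field_simp; norm_num
    have e2 : ((n : ℚ) + 1) / 2 ^ (2 * (n + 1)) ≤ 1 / 4 * (1 / 2 ^ n) := by
      rw [show 2 * (n + 1) = n + n + 2 by ring, pow_add, pow_add]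
      rw [mul_one_div, div_div, div_le_div_iff₀ (by positivity) (by positivity)]
      have : (n : ℚ) + 1 ≤ 2 ^ n := by exact_mod_cast (Nat.lt_two_pow_self : n < 2 ^ n)
      have hp : (0 : ℚ) < 2 ^ n := by positivity
      nlinarith
    have k0 := key false
    have k1 := key true
    rw [Zpre, ← hσ]
    rw [e1] at hd
    rw [show (1 : ℚ) / 2 ^ (n + 1) = 1 / 2 * (1 / 2 ^ n) by rw [pow_succ]; field_simp]
    linarith

theorem key_stage (s n p : ℕ) (hp : p < n) (h : n ≤ s) (hs : small p s) : ¬ V p s (Zpre s n) := by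
  intro hV
  have h1 : dd p s (Zpre s n) = 1 := by
    unfold dd
    rw [if_pos hs, cnt_eq, cn_all _ (fun τ => V_up (List.prefix_append _ _) hV)]
    push_cast
    exact div_self (by positivity)
  have h2 : dd p s (Zpre s n) ≤ SS s (Zpre s n) := by
    unfold SS
    refine Finset.single_le_sum (f := fun p => dd p s (Zpre s n)) (fun q _ => dd_nonneg q s _) ?_
    rw [length_Zpre]; exact Finset.mem_range.2 hp
  have h3 := SS_bound s n h
  have h4 : (0 : ℚ) < 1 / 2 ^ n := by positivity
  linarith

theorem key_lim (p n : ℕ) (hp : p < n) : ∃ s0, ∀ s, s0 ≤ s → small p s → ¬ V p s (restr Z n) := by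
  obtain ⟨s0, h0⟩ := Zpre_lim n
  refine ⟨max s0 n, fun s hs hsm => ?_⟩
  rw [← h0 s (by omega)]
  exact key_stage s n p hp (by omega) hsm

end Grb

namespace Grb
open Nat.Partrec

theorem code_part {f : ℕ →. ℕ} (hf : Nat.Partrec f) : ∃ e, ∀ x v, (∃ s, ev s e x = some v) ↔ v ∈ f x := by
  obtain ⟨c, hc⟩ := Code.exists_code.1 hf
  refine ⟨encode c, fun x v => ?_⟩
  unfold ev
  rw [Denumerable.ofNat_encode, ← hc]
  exact Code.evaln_complete.symm

theorem code_tot {f : ℕ → ℕ} (hf : Computable f) : ∃ e, ∀ x v, (∃ s, ev s e x = some v) ↔ v = f x := by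
  obtain ⟨e, he⟩ := code_part (Partrec.nat_iff.1 hf.partrec)
  refine ⟨e, fun x v => (he x v).trans ?_⟩
  exact Part.mem_some_iff

theorem ca_pair (a f g b k : ℕ) : ca (Nat.pair (Nat.pair (Nat.pair a f) (Nat.pair g b)) k) = a := by simp [ca]
theorem cf_pair (a f g b k : ℕ) : cf (Nat.pair (Nat.pair (Nat.pair a f) (Nat.pair g b)) k) = f := by simp [cf]
theorem cg_pair (a f g b k : ℕ) : cg (Nat.pair (Nat.pair (Nat.pair a f) (Nat.pair g b)) k) = g := by simp [cg]
theorem cb_pair (a f g b k : ℕ) : cb (Nat.pair (Nat.pair (Nat.pair a f) (Nat.pair g b)) k) = b := by simp [cb]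

def pcount (σ : ℕ → List Bool) (τ : List Bool) (K : ℕ) : ℕ :=
  ((Finset.range K).filter (fun i => σ i <+: τ)).card

theorem computable_pcount (σ : ℕ → List Bool) (hσ : Computable σ) : Computable₂ (pcount σ) := by
  have hpre : Computable (fun z : List Bool × List Bool => decide (z.1 = z.2.take z.1.length)) := by
    have : PrimrecPred (fun z : List Bool × List Bool => z.1 = z.2.take z.1.length) :=
      Primrec.eq.comp Primrec.fst (Primrec.list_take.comp (Primrec.list_length.comp Primrec.fst) Primrec.snd)
    exact this.decide.to_comp
  have hg : Computable₂ (fun (q : List Bool × ℕ) (z : ℕ × ℕ) => z.2 + cond (decide (σ z.1 = q.1.take (σ z.1).length)) 1 0) := by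
    have hs : Computable (fun w : (List Bool × ℕ) × (ℕ × ℕ) => σ w.2.1) := hσ.comp (Computable.fst.comp Computable.snd)
    have ht : Computable (fun w : (List Bool × ℕ) × (ℕ × ℕ) => w.1.1) := Computable.fst.comp Computable.fst
    have h1 : Computable (fun w : (List Bool × ℕ) × (ℕ × ℕ) => decide (σ w.2.1 = w.1.1.take (σ w.2.1).length)) := by
      have := hpre.comp (Computable.pair hs ht)
      exact this
    have h2 : Computable (fun w : (List Bool × ℕ) × (ℕ × ℕ) => cond (decide (σ w.2.1 = w.1.1.take (σ w.2.1).length)) 1 0) :=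
      Computable.cond h1 (Computable.const 1) (Computable.const 0)
    have := (Primrec.nat_add.to_comp).comp (Computable.snd.comp Computable.snd) h2
    exact this
  refine (Computable.nat_rec (f := fun q : List Bool × ℕ => q.2) (g := fun _ => 0) Computable.snd (Computable.const 0) hg).of_eq ?_
  rintro ⟨τ, K⟩
  simp only [pcount]
  induction K with
  | zero => rfl
  | succ K ih =>
    simp only [ih, Finset.range_add_one, Finset.filter_insert]
    by_cases h : σ K <+: τ
    · have h' := List.prefix_iff_eq_take.1 h
      rw [if_pos h, Finset.card_insert_of_notMem (by simp)]
      simp [← h']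
    · have h' : ¬ (σ K = τ.take (σ K).length) := fun h2 => h (List.prefix_iff_eq_take.2 h2)
      rw [if_neg h]
      simp [h']

theorem tail_le (u : ℕ → ℝ) (h0 : ∀ i, 0 ≤ u i) (hu : Summable u) : ∃ N, ∀ K, ∑ i ∈ Finset.range K, u (i + N) ≤ 1 := by
  have h1 := tendsto_sum_nat_add u
  have h2 : ∀ᶠ N in Filter.atTop, ∑' k, u (k + N) < 1 := h1.eventually (gt_mem_nhds one_pos)
  obtain ⟨N, hN⟩ := h2.exists
  refine ⟨N, fun K => ?_⟩
  have h3 : Summable (fun k => u (k + N)) := (summable_nat_add_iff N).2 hu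
  exact (h3.sum_le_tsum _ (fun i _ => h0 _)).trans hN.le

theorem markov_small (σ : ℕ → List Bool) (hN : ∀ K, ∑ i ∈ Finset.range K, ((1 : ℝ) / 2) ^ (σ i).length ≤ 1) (s M : ℕ) :
    cn (fun τ => M ≤ pcount σ τ s) s * M ≤ 2 ^ s := by
  classical
  have h3 := cn_markov (Finset.range s) (fun i τ => σ i <+: τ) s M
  have h4 : (fun τ => M ≤ pcount σ τ s) = (fun τ => M ≤ (@Finset.filter ℕ (fun i => σ i <+: τ) (fun _ => Classical.propDecidable _) (Finset.range s)).card) := by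
    funext τ
    unfold pcount
    congr!
  rw [h4]
  refine le_trans h3 ?_
  clear h3 h4
  have h2 : ((∑ i ∈ Finset.range s, cn (fun τ => σ i <+: τ) s : ℕ) : ℝ) ≤ 2 ^ s := by
    push_cast
    calc ∑ i ∈ Finset.range s, (cn (fun τ => σ i <+: τ) s : ℝ) ≤ ∑ i ∈ Finset.range s, 2 ^ s * ((1 : ℝ) / 2) ^ (σ i).length := by
          refine Finset.sum_le_sum fun i _ => ?_
          rw [div_pow, one_pow, mul_one_div, le_div_iff₀ (by positivity)]
          exact_mod_cast cn_isPre (σ i) s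
      _ = 2 ^ s * ∑ i ∈ Finset.range s, ((1 : ℝ) / 2) ^ (σ i).length := by rw [Finset.mul_sum]
      _ ≤ 2 ^ s * 1 := mul_le_mul_of_nonneg_left (hN s) (by positivity)
      _ = 2 ^ s := mul_one _
  exact_mod_cast h2

theorem Z_random : MLRandom Z := by
  classical
  intro σ0 hσ0 hsum
  obtain ⟨N, hN⟩ := tail_le _ (fun i => by positivity) hsum
  by_contra hinf
  let σ : ℕ → List Bool := fun i => σ0 (i + N)
  have hσ : Computable σ := hσ0.comp (Primrec.to_comp (Primrec.nat_add.comp Primrec.id (Primrec.const N)))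
  have hinf' : {i | InitSeg (σ i) Z}.Infinite := by
    intro hf
    apply hinf
    refine ((Set.finite_lt_nat N).union (hf.image (fun i => i + N))).subset ?_
    intro i hi
    by_cases hiN : i < N
    · exact Or.inl hiN
    · right
      refine ⟨i - N, ?_, by simp only; omega⟩
      simp only [Set.mem_ofPred_eq, σ]
      rw [show i - N + N = i by omega]
      exact hi
  let F : ℕ → ℕ := fun m => cond (decide (4 ^ (m.unpair.1 + 2) ≤ pcount σ ((decode (α := List Bool) m.unpair.2.unpair.1).getD []) ((decode (α := List Bool) m.unpair.2.unpair.1).getD []).length)) 0 1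
  have hF : Computable F := by
    have hτ : Primrec (fun m : ℕ => (decode (α := List Bool) m.unpair.2.unpair.1).getD []) :=
      Primrec.option_getD.comp (Primrec.decode.comp (Primrec.fst.comp (Primrec.unpair.comp (Primrec.snd.comp Primrec.unpair)))) (Primrec.const [])
    have h1 : Computable (fun m : ℕ => pcount σ ((decode (α := List Bool) m.unpair.2.unpair.1).getD []) ((decode (α := List Bool) m.unpair.2.unpair.1).getD []).length) := by
      have := (computable_pcount σ hσ).comp hτ.to_comp (Primrec.list_length.comp hτ).to_comp
      exact this
    have h2 : Computable (fun m : ℕ => 4 ^ (m.unpair.1 + 2)) :=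
      Primrec.to_comp (primrec_pow.comp (Primrec.const 4) (Primrec.nat_add.comp (Primrec.fst.comp Primrec.unpair) (Primrec.const 2)))
    have h3 : Computable (fun z : ℕ × ℕ => decide (z.1 ≤ z.2)) := by
      have : PrimrecPred (fun z : ℕ × ℕ => z.1 ≤ z.2) := Primrec.nat_le
      exact this.decide.to_comp
    have h4 := h3.comp (Computable.pair h2 h1)
    have h5 := Computable.cond h4 (Computable.const 0) (Computable.const 1)
    exact h5
  obtain ⟨a, ha⟩ := code_part (f := fun _ => Part.none) Nat.Partrec.none
  obtain ⟨f, hf⟩ := code_tot hF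
  obtain ⟨b, hb⟩ := code_tot (f := fun _ => 0) (Computable.const 0)
  set p := Nat.pair (Nat.pair (Nat.pair a f) (Nat.pair b b)) 0 with hp
  have hca : ca p = a := ca_pair _ _ _ _ _
  have hcf : cf p = f := cf_pair _ _ _ _ _
  have hcb : cb p = b := cb_pair _ _ _ _ _
  have hAs : ∀ s y, As (ca p) s y = false := by
    intro s y
    unfold As
    rw [hca]
    rcases h : ev s a y with _ | v
    · rfl
    · exact absurd ((ha y v).1 ⟨s, h⟩) (Part.notMem_none v)
  have hX : ∀ s, X p s = (1, 0) := by
    intro s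
    induction s with
    | zero => rfl
    | succ s ih =>
      rw [X, ih, if_neg]
      rintro ⟨-, h⟩
      rw [hcb] at h
      rcases h' : ev s b p with _ | v
      · rw [h'] at h; simp at h
      · have := (hb p v).1 ⟨s, h'⟩
        rw [h', this] at h; simp at h
  have hFv : ∀ τ, F (Nat.pair p (Nat.pair (encode τ) 0)) = 0 ↔ 4 ^ (p + 2) ≤ pcount σ τ τ.length := by
    intro τ
    simp only [F, Nat.unpair_pair, encodek, Option.getD_some]
    by_cases h : 4 ^ (p + 2) ≤ pcount σ τ τ.length <;> simp [h]
  have hV1 : ∀ s τ, V p s τ → 4 ^ (p + 2) ≤ pcount σ τ τ.length := by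
    intro s τ h
    obtain ⟨n, hn, he⟩ := h 0 (by rw [hX]; norm_num)
    rw [hAs, hcf] at he
    have := (hf _ _).1 ⟨s, he⟩
    have := (hFv (τ.take n)).1 this.symm
    refine this.trans (Finset.card_le_card ?_)
    intro i hi
    simp only [Finset.mem_filter, Finset.mem_range] at hi ⊢
    exact ⟨lt_of_lt_of_le hi.1 (by simp), hi.2.trans (List.take_prefix _ _)⟩
  have hsmall : ∀ s, small p s := by
    intro s
    unfold small
    refine (Nat.mul_le_mul_right _ (cn_mono s fun τ hτ h => ?_)).trans (markov_small σ hN s (4 ^ (p + 2)))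
    have := hV1 s τ h
    rw [hτ] at this
    exact this
  obtain ⟨T, hT1, hT2⟩ := hinf'.exists_subset_card_eq (4 ^ (p + 2))
  let n := p + 1 + ∑ i ∈ T, (i + 1 + (σ i).length)
  have hn : ∀ i ∈ T, i + 1 + (σ i).length ≤ n := by
    intro i hi
    have := Finset.single_le_sum (f := fun i => i + 1 + (σ i).length) (fun _ _ => Nat.zero_le _) hi
    omega
  have hM : 4 ^ (p + 2) ≤ pcount σ (restr Z n) (restr Z n).length := by
    rw [← hT2]
    refine Finset.card_le_card ?_
    intro i hi
    have h1 := hn i hi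
    have h2 : InitSeg (σ i) Z := hT1 hi
    simp only [Finset.mem_filter, Finset.mem_range, length_restr]
    refine ⟨by omega, ?_⟩
    unfold InitSeg at h2
    rw [h2]
    exact restr_isPre Z (by omega)
  obtain ⟨s1, h1⟩ := (hf _ _).2 ((hFv _).2 hM).symm
  obtain ⟨s0, h0⟩ := key_lim p n (by omega)
  refine h0 (max s0 s1) (le_max_left _ _) (hsmall _) ?_
  intro y hy
  rw [hX] at hy
  have hy0 : y = 0 := by simp only at hy; omega
  subst hy0
  refine ⟨(restr Z n).length, Nat.lt_succ_self _, ?_⟩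
  rw [hAs, hcf, List.take_length]
  exact ev_mono (le_max_right _ _) h1

end Grb

namespace Grb
open Nat.Partrec

def kap (p : ℕ) : ℕ := 2 * Nat.pair p.unpair.1 (p.unpair.2 + 1) + 4 + p.unpair.2 + 1

theorem primrec_kap : Primrec kap := by
  have h1 : Primrec (fun p : ℕ => p.unpair.1) := Primrec.fst.comp Primrec.unpair
  have h2 : Primrec (fun p : ℕ => p.unpair.2) := Primrec.snd.comp Primrec.unpair
  exact Primrec.succ.comp (Primrec.nat_add.comp (Primrec.nat_add.comp (Primrec.nat_mul.comp (Primrec.const 2) (Primrec₂.natPair.comp h1 (Primrec.succ.comp h2))) (Primrec.const 4)) h2)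

structure SU (A : ℕ → Bool) (c : ℕ → ℕ → ℚ) (F : List Bool → ℕ →. ℕ) (a f g b e : ℕ) (bd : ℕ → ℕ) : Prop where
  he : e = Nat.pair (Nat.pair a f) (Nat.pair g b)
  hA : ∀ y, A y = true ↔ ∃ s, As a s y = true
  hF2 : ∀ σ τ x y, σ <+: τ → y ∈ F σ x → y ∈ F τ x
  hF3 : ∀ x, ∃ n, (A x).toNat ∈ F (restr Z n) x
  hf : ∀ p τ y v, (∃ s, ev s f (Nat.pair p (Nat.pair (encode τ) y)) = some v) ↔ v ∈ F τ y
  hc0 : ∀ x s, 0 ≤ c x s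
  hct : ∀ x s t, s ≤ t → c x s ≤ c x t
  hcx : ∀ x y s, x ≤ y → c y s ≤ c x s
  hg : ∀ p x t v, (∃ s, ev s g (Nat.pair p (Nat.pair x t)) = some v) ↔ v = (decide (((1:ℚ)/2) ^ kap p ≤ c x t)).toNat
  hb : ∀ p v, (∃ s, ev s b p = some v) ↔ v = bd (kap p)
  hben : ∀ k m (x s : ℕ → ℕ), (∀ i, i < m → x i < s i) →
      (∀ i, i + 1 < m → s i ≤ x (i + 1)) →
      (∀ i, i < m → ((1 : ℚ) / 2) ^ k ≤ c (x i) (s i)) → m ≤ bd k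

def Chn (c : ℕ → ℕ → ℚ) (k m B : ℕ) : Prop := ∃ x s : ℕ → ℕ, (∀ i, i < m → x i < s i) ∧
      (∀ i, i + 1 < m → s i ≤ x (i + 1)) ∧
      (∀ i, i < m → ((1 : ℚ) / 2) ^ k ≤ c (x i) (s i)) ∧ ∀ i, i < m → s i ≤ B

theorem Chn_ext {c : ℕ → ℕ → ℚ} {k m B x t B' : ℕ} (h : Chn c k m B) (h1 : B ≤ x) (h2 : x < t) (h3 : t ≤ B')
    (h4 : ((1 : ℚ) / 2) ^ k ≤ c x t) : Chn c k (m + 1) B' := by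
  obtain ⟨xs, ss, a1, a2, a3, a4⟩ := h
  refine ⟨fun i => if i = m then x else xs i, fun i => if i = m then t else ss i, ?_, ?_, ?_, ?_⟩
  · intro i hi
    by_cases e : i = m
    · simp [e, h2]
    · simp only [e, if_false]; exact a1 i (by omega)
  · intro i hi
    have e : i ≠ m := by omega
    simp only [e, if_false]
    by_cases e' : i + 1 = m
    · simp only [e', if_true]; exact (a4 i (by omega)).trans h1
    · simp only [e', if_false]; exact a2 i (by omega)
  · intro i hi
    by_cases e : i = m
    · simp [e]; simpa using h4
    · simp only [e, if_false]; exact a3 i (by omega)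
  · intro i hi
    by_cases e : i = m
    · simp [e, h3]
    · simp only [e, if_false]
      have := a4 i (by omega)
      omega

section
variable {A : ℕ → Bool} {c : ℕ → ℕ → ℚ} {F : List Bool → ℕ →. ℕ} {a f g b e : ℕ} {bd : ℕ → ℕ}

theorem SU.ca_eq (S : SU A c F a f g b e bd) (k : ℕ) : ca (Nat.pair e k) = a := by rw [S.he]; exact ca_pair _ _ _ _ _
theorem SU.cf_eq (S : SU A c F a f g b e bd) (k : ℕ) : cf (Nat.pair e k) = f := by rw [S.he]; exact cf_pair _ _ _ _ _
theorem SU.cg_eq (S : SU A c F a f g b e bd) (k : ℕ) : cg (Nat.pair e k) = g := by rw [S.he]; exact cg_pair _ _ _ _ _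
theorem SU.cb_eq (S : SU A c F a f g b e bd) (k : ℕ) : cb (Nat.pair e k) = b := by rw [S.he]; exact cb_pair _ _ _ _ _

theorem SU.chain (S : SU A c F a f g b e bd) (k s : ℕ) :
    Chn c (kap (Nat.pair e k)) (X (Nat.pair e k) s).2 (X (Nat.pair e k) s).1 := by
  induction s with
  | zero => exact ⟨id, id, by simp [X], by simp [X], by simp [X], by simp [X]⟩
  | succ s ih =>
    rw [X]
    split_ifs with h
    · obtain ⟨⟨t, h1, h2, h3⟩, _⟩ := h
      refine Chn_ext ih le_rfl h2 (by simp only; omega) ?_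
      rw [S.cg_eq] at h3
      have := (S.hg _ _ _ _).1 ⟨s, h3⟩
      by_contra hh
      rw [decide_eq_false hh] at this
      simp at this
    · exact ih

theorem SU.lim (S : SU A c F a f g b e bd) (k : ℕ) : ∃ s0, (∀ s, s0 ≤ s → X (Nat.pair e k) s = X (Nat.pair e k) s0) ∧
    ∀ t, c (X (Nat.pair e k) s0).1 t < ((1 : ℚ) / 2) ^ kap (Nat.pair e k) := by
  set p := Nat.pair e k with hp
  obtain ⟨s0, h0⟩ := X_conv p
  refine ⟨s0, h0, ?_⟩
  by_contra hcon
  push Not at hcon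
  obtain ⟨t0, ht0⟩ := hcon
  set x := (X p s0).1 with hx
  set t := max t0 (x + 1) with ht
  have hct : ((1 : ℚ) / 2) ^ kap p ≤ c x t := ht0.trans (S.hct _ _ _ (le_max_left _ _))
  have hxt : x < t := by omega
  have hch : Chn c (kap p) ((X p s0).2 + 1) t := Chn_ext (S.chain k s0) le_rfl hxt le_rfl hct
  obtain ⟨xs, ss, a1, a2, a3, _⟩ := hch
  have hj := S.hben _ _ xs ss a1 a2 a3
  obtain ⟨s1, h1⟩ := (S.hb p _).2 rfl
  obtain ⟨s2, h2⟩ := (S.hg p x t _).2 rfl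
  rw [decide_eq_true hct] at h2
  let s := max (max s0 t) (max s1 s2)
  have hXs : X p s = X p s0 := h0 s (by omega)
  have hXs1 : X p (s + 1) = X p s0 := h0 (s + 1) (by omega)
  have htr : trig p s (X p s).1 ∧ (X p s).2 < (ev s (cb p) p).getD 0 := by
    rw [hXs]
    refine ⟨⟨t, by omega, hxt, ?_⟩, ?_⟩
    · rw [S.cg_eq]
      exact ev_mono (by omega) h2
    · rw [S.cb_eq, ev_mono (by omega : s1 ≤ s) h1]
      simp only [Option.getD_some]
      omega
  rw [X, if_pos htr, hXs] at hXs1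
  have := congrArg Prod.snd hXs1
  simp only at this
  omega

theorem SU.As_le (S : SU A c F a f g b e bd) {s y : ℕ} (h : As a s y = true) : A y = true := (S.hA y).2 ⟨s, h⟩

theorem SU.As_ev (S : SU A c F a f g b e bd) (y : ℕ) : ∀ᶠ s in Filter.atTop, As a s y = A y := by
  rw [Filter.eventually_atTop]
  cases hy : A y with
  | true =>
    obtain ⟨s0, h0⟩ := (S.hA y).1 hy
    exact ⟨s0, fun s hs => As_mono hs h0⟩
  | false =>
    refine ⟨0, fun s _ => ?_⟩
    by_contra h
    have := S.As_le (s := s) (y := y) (by simpa using h)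
    simp [hy] at this

theorem SU.X_ev (S : SU A c F a f g b e bd) (k : ℕ) : ∃ x, (∀ᶠ s in Filter.atTop, (X (Nat.pair e k) s).1 = x) ∧
    ∀ t, c x t < ((1 : ℚ) / 2) ^ kap (Nat.pair e k) := by
  obtain ⟨s0, h0, h1⟩ := S.lim k
  exact ⟨(X (Nat.pair e k) s0).1, Filter.eventually_atTop.2 ⟨s0, fun s hs => by rw [h0 s hs]⟩, h1⟩

theorem SU.big_ev (S : SU A c F a f g b e bd) (k : ℕ) : ∀ᶠ s in Filter.atTop, ¬ small (Nat.pair e k) s := by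
  set p := Nat.pair e k with hp
  obtain ⟨x, hx, -⟩ := S.X_ev k
  choose n hn using S.hF3
  let N := p + 1 + ∑ y ∈ Finset.range x, n y
  have hN : ∀ y < x, n y ≤ N := by
    intro y hy
    have := Finset.single_le_sum (f := n) (fun _ _ => Nat.zero_le _) (Finset.mem_range.2 hy)
    omega
  have hev : ∀ᶠ s in Filter.atTop, ∀ y ∈ Finset.range x,
      ev s (cf p) (Nat.pair p (Nat.pair (encode ((restr Z N).take (n y))) y)) = some (As (ca p) s y).toNat := by
    rw [Filter.eventually_all_finset]
    intro y hy
    have hy' := hN y (Finset.mem_range.1 hy)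
    have e1 : (restr Z N).take (n y) = restr Z (n y) := by
      have := List.prefix_iff_eq_take.1 (restr_isPre Z hy')
      rw [length_restr] at this
      exact this.symm
    obtain ⟨s1, h1⟩ := (S.hf p (restr Z (n y)) y _).2 (hn y)
    filter_upwards [S.As_ev y, Filter.eventually_ge_atTop s1] with s h2 h3
    rw [S.ca_eq, S.cf_eq, h2, e1]
    exact ev_mono h3 h1
  obtain ⟨s0, h0⟩ := key_lim p N (by omega)
  filter_upwards [hx, hev, Filter.eventually_ge_atTop s0] with s h1 h2 h3 h4
  refine h0 s h3 h4 ?_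
  intro y hy
  rw [h1] at hy
  refine ⟨n y, ?_, h2 y (Finset.mem_range.2 hy)⟩
  rw [length_restr]
  exact Nat.lt_succ_of_le (hN y hy)

def QQ (e g i t : ℕ) : Prop := i ≤ t ∧ ∀ k < i + 1, ¬ small (Nat.pair e k) t ∧
  ∀ j < i + 1, ev t g (Nat.pair (Nat.pair e k) (Nat.pair (X (Nat.pair e k) t).1 (j + 1))) = some 0

theorem primrec_QQ (e g : ℕ) : PrimrecRel (QQ e g) := by
  have h1 : PrimrecRel (fun (j : ℕ) (z : ℕ × ℕ × ℕ) =>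
      ev z.2.2 g (Nat.pair (Nat.pair e z.1) (Nat.pair (X (Nat.pair e z.1) z.2.2).1 (j + 1))) = some 0) := by
    have hk : Primrec (fun w : ℕ × ℕ × ℕ × ℕ => Nat.pair e w.2.1) := Primrec₂.natPair.comp (Primrec.const e) (Primrec.fst.comp Primrec.snd)
    have ht : Primrec (fun w : ℕ × ℕ × ℕ × ℕ => w.2.2.2) := Primrec.snd.comp (Primrec.snd.comp Primrec.snd)
    refine Primrec.eq.comp (primrec_ev' ht (Primrec.const g) (Primrec₂.natPair.comp hk (Primrec₂.natPair.comp ?_ ?_))) (Primrec.const (some 0))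
    · exact Primrec.fst.comp (primrec_X.comp hk ht)
    · exact Primrec.succ.comp Primrec.fst
  have h2 : PrimrecRel (fun (k : ℕ) (z : ℕ × ℕ) => ¬ small (Nat.pair e k) z.2 ∧ ∀ j < z.1 + 1,
      ev z.2 g (Nat.pair (Nat.pair e k) (Nat.pair (X (Nat.pair e k) z.2).1 (j + 1))) = some 0) := by
    have ht : Primrec (fun w : ℕ × ℕ × ℕ => w.2.2) := Primrec.snd.comp Primrec.snd
    refine PrimrecPred.and (PrimrecPred.not ?_) ?_
    · exact primrec_small.comp (Primrec₂.natPair.comp (Primrec.const e) Primrec.fst) ht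
    · exact (forall_lt_gen h1).comp (Primrec.succ.comp (Primrec.fst.comp Primrec.snd)) Primrec.id
  exact PrimrecPred.and (Primrec.nat_le.comp Primrec.fst Primrec.snd)
    ((forall_lt_gen h2).comp (Primrec.succ.comp Primrec.fst) Primrec.id)

theorem QQ_anti {i i' t : ℕ} (h : i ≤ i') (hQ : QQ e g i' t) : QQ e g i t :=
  ⟨h.trans hQ.1, fun k hk => ⟨(hQ.2 k (by omega)).1, fun j hj => (hQ.2 k (by omega)).2 j (by omega)⟩⟩

theorem SU.QQ_ex (S : SU A c F a f g b e bd) (i : ℕ) : ∃ t, QQ e g i t := by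
  have : ∀ᶠ t in Filter.atTop, ∀ k ∈ Finset.range (i + 1), ¬ small (Nat.pair e k) t ∧
      ∀ j ∈ Finset.range (i + 1), ev t g (Nat.pair (Nat.pair e k) (Nat.pair (X (Nat.pair e k) t).1 (j + 1))) = some 0 := by
    rw [Filter.eventually_all_finset]
    intro k _
    refine (S.big_ev k).and ?_
    rw [Filter.eventually_all_finset]
    intro j _
    obtain ⟨x, hx, hc⟩ := S.X_ev k
    obtain ⟨s1, h1⟩ := (S.hg (Nat.pair e k) x (j + 1) _).2 rfl
    rw [decide_eq_false (not_le.2 (hc (j + 1)))] at h1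
    filter_upwards [hx, Filter.eventually_ge_atTop s1] with t h2 h3
    rw [h2]
    exact ev_mono h3 h1
  obtain ⟨t, h1, h2⟩ := (this.and (Filter.eventually_ge_atTop i)).exists
  exact ⟨t, h2, fun k hk => ⟨(h1 k (Finset.mem_range.2 hk)).1, fun j hj => (h1 k (Finset.mem_range.2 hk)).2 j (Finset.mem_range.2 hj)⟩⟩

open Classical in
theorem T_computable (h : ∀ i, ∃ t, QQ e g i t) : Computable (fun i => Nat.find (h i)) := by
  have h1 : Computable₂ (fun i t => decide (QQ e g i t)) := by
    have := (primrec_QQ e g).decide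
    exact this.to_comp
  refine (Partrec.rfind h1.partrec₂).of_eq_tot ?_
  intro i
  refine Nat.mem_rfind.2 ⟨?_, fun {m} hm => ?_⟩
  · refine Part.mem_some_iff.2 (Eq.symm ?_)
    rw [decide_eq_true_iff]
    exact Nat.find_spec (h i)
  · refine Part.mem_some_iff.2 (Eq.symm ?_)
    rw [decide_eq_false_iff_not]
    exact Nat.find_min (h i) hm

def NN (a e : ℕ) (T : ℕ → ℕ) (k i : ℕ) : Prop := k + 1 ≤ i ∧ ∃ y < (X (Nat.pair e k) (T (i - 1))).1, As a (T i) y ≠ As a (T (i - 1)) y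

theorem SU.claim1 (S : SU A c F a f g b e bd) (T : ℕ → ℕ) (hT : ∀ i, QQ e g i (T i)) (k i : ℕ) (hk : k + 1 ≤ i)
    (hN : ¬ NN a e T k i) : stageCost c (fun i y => As a (T i) y) i ≤ ((1 : ℚ) / 2) ^ kap (Nat.pair e k) := by
  unfold stageCost
  rw [if_neg (by omega)]
  split_ifs with h
  · have h1 := Nat.find_spec h
    set y := Nat.find h
    have h2 : (X (Nat.pair e k) (T (i - 1))).1 ≤ y := by
      by_contra hlt
      exact hN ⟨hk, y, by omega, h1⟩
    have h3 := ((hT (i - 1)).2 k (by omega)).2 (i - 1) (by omega)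
    have h4 := (S.hg _ _ _ _).1 ⟨_, h3⟩
    rw [show i - 1 + 1 = i by omega] at h4
    refine (S.hcx _ _ i h2).trans ?_
    by_contra hcon
    rw [decide_eq_true (not_le.1 hcon).le] at h4
    simp at h4
  · positivity

theorem SU.stage_nonneg (S : SU A c F a f g b e bd) (Bs : ℕ → ℕ → Bool) (i : ℕ) : 0 ≤ stageCost c Bs i := by
  unfold stageCost
  split_ifs
  · exact le_rfl
  · exact S.hc0 _ _
  · exact le_rfl

theorem SU.claim2 (S : SU A c F a f g b e bd) (T : ℕ → ℕ) (hT : ∀ i, QQ e g i (T i)) (hTm : Monotone T) (k : ℕ)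
    (N : Finset ℕ) (hN : ∀ i ∈ N, NN a e T k i) : N.card ≤ 4 ^ (Nat.pair e k + 2) := by
  set p := Nat.pair e k with hp
  have hdis : ∀ i j τ, i < j → NN a e T k i → NN a e T k j → V p (T (i - 1)) τ → V p (T (j - 1)) τ → False := by
    intro i j τ hij hi hj hVi hVj
    obtain ⟨hki, y, hy, hne⟩ := hi
    have hij' : T i ≤ T (j - 1) := hTm (by omega)
    have hii : T (i - 1) ≤ T i := hTm (by omega)
    have hA1 : As a (T (i - 1)) y = false ∧ As a (T i) y = true := by
      cases h1 : As a (T (i - 1)) y with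
      | true => exact absurd ((As_mono hii h1).trans h1.symm) hne
      | false =>
        rw [h1] at hne
        exact ⟨rfl, by simpa using hne⟩
    have hA2 : As a (T (j - 1)) y = true := As_mono hij' hA1.2
    obtain ⟨n, _, h1⟩ := hVi y hy
    obtain ⟨m, _, h2⟩ := hVj y (lt_of_lt_of_le hy (X_mono _ (hii.trans hij')))
    rw [S.ca_eq, S.cf_eq] at h1 h2
    rw [hA1.1] at h1
    rw [hA2] at h2
    have k1 := S.hF2 _ τ _ _ (List.take_prefix _ _) ((S.hf _ _ _ _).1 ⟨_, h1⟩)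
    have k2 := S.hF2 _ τ _ _ (List.take_prefix _ _) ((S.hf _ _ _ _).1 ⟨_, h2⟩)
    have := Part.mem_unique k1 k2
    simp at this
  let L := ∑ i ∈ N, T (i - 1)
  have hL : ∀ i ∈ N, T (i - 1) ≤ L := fun i hi =>
    Finset.single_le_sum (f := fun i => T (i - 1)) (fun _ _ => Nat.zero_le _) hi
  have h1 : ∑ i ∈ N, cn (V p (T (i - 1))) L ≤ 2 ^ L := by
    refine cn_disj N (fun i => V p (T (i - 1))) L ?_
    intro i hi j hj τ h1 h2
    rcases lt_trichotomy i j with h | h | h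
    · exact (hdis i j τ h (hN i hi) (hN j hj) h1 h2).elim
    · exact h
    · exact (hdis j i τ h (hN j hj) (hN i hi) h2 h1).elim
  have h2 : ∀ i ∈ N, 2 ^ L ≤ cn (V p (T (i - 1))) L * 4 ^ (p + 2) := by
    intro i hi
    have hk := (hN i hi).1
    have hs := ((hT (i - 1)).2 k (by omega)).1
    unfold small at hs
    push Not at hs
    have h3 : cn (V p (T (i - 1))) (T (i - 1)) * 2 ^ (L - T (i - 1)) ≤ cn (V p (T (i - 1))) L :=
      cn_up_le (fun τ b h => V_up (List.prefix_append _ _) h) (hL i hi)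
    have h4 : 2 ^ L = 2 ^ T (i - 1) * 2 ^ (L - T (i - 1)) := by
      rw [← pow_add]; congr 1; have := hL i hi; omega
    have h5 : 2 ^ T (i - 1) ≤ cn (V p (T (i - 1))) (T (i - 1)) * 4 ^ (p + 2) := hs.le
    calc 2 ^ L = 2 ^ T (i - 1) * 2 ^ (L - T (i - 1)) := h4
      _ ≤ cn (V p (T (i - 1))) (T (i - 1)) * 4 ^ (p + 2) * 2 ^ (L - T (i - 1)) := Nat.mul_le_mul_right _ h5
      _ = cn (V p (T (i - 1))) (T (i - 1)) * 2 ^ (L - T (i - 1)) * 4 ^ (p + 2) := by ring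
      _ ≤ _ := Nat.mul_le_mul_right _ h3
  have h3 : N.card * 2 ^ L ≤ 4 ^ (p + 2) * 2 ^ L := by
    calc N.card * 2 ^ L = ∑ i ∈ N, 2 ^ L := by simp
      _ ≤ ∑ i ∈ N, cn (V p (T (i - 1))) L * 4 ^ (p + 2) := Finset.sum_le_sum h2
      _ = (∑ i ∈ N, cn (V p (T (i - 1))) L) * 4 ^ (p + 2) := by rw [Finset.sum_mul]
      _ ≤ 2 ^ L * 4 ^ (p + 2) := Nat.mul_le_mul_right _ h1
      _ = _ := mul_comm _ _
  exact Nat.le_of_mul_le_mul_right h3 (by positivity)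

theorem kap_pair (e k : ℕ) : kap (Nat.pair e k) = 2 * (Nat.pair e (k + 1) + 2) + (k + 1) := by
  simp [kap]; ring

theorem half_sum (n : ℕ) : ∑ i ∈ Finset.range n, ((1 : ℚ) / 2) ^ (i + 1) ≤ 1 := by
  have : ∑ i ∈ Finset.range n, ((1 : ℚ) / 2) ^ (i + 1) = 1 - (1 / 2) ^ n := by
    induction n with
    | zero => simp
    | succ n ih => rw [Finset.sum_range_succ, ih]; ring
  rw [this]
  have : (0 : ℚ) < (1 / 2) ^ n := by positivity
  linarith

theorem SU.total (S : SU A c F a f g b e bd) (T : ℕ → ℕ) (hT : ∀ i, QQ e g i (T i)) (hTm : Monotone T) :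
    ∃ B : ℚ, ∀ G : Finset ℕ, ∑ s ∈ G, stageCost c (fun i y => As a (T i) y) s ≤ B := by
  classical
  set C := stageCost c (fun i y => As a (T i) y) with hC
  have hC0 : ∀ i, 0 ≤ C i := fun i => S.stage_nonneg _ i
  have hfin : {i | NN a e T 0 i}.Finite := by
    by_contra hinf
    obtain ⟨N, hN1, hN2⟩ := Set.Infinite.exists_subset_card_eq hinf (4 ^ (Nat.pair e 0 + 2) + 1)
    have := S.claim2 T hT hTm 0 N (fun i hi => hN1 hi)
    omega
  have hdich : ∀ i m, m + 1 ≤ i → NN a e T 0 i ∨ (∃ k < m, NN a e T (k + 1) i ∧ C i ≤ (1 / 2) ^ kap (Nat.pair e k)) ∨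
      C i ≤ (1 / 2) ^ kap (Nat.pair e m) := by
    intro i m
    induction m with
    | zero =>
      intro hi
      by_cases h : NN a e T 0 i
      · exact Or.inl h
      · exact Or.inr (Or.inr (S.claim1 T hT 0 i hi h))
    | succ m ih =>
      intro hi
      by_cases h : NN a e T (m + 1) i
      · rcases ih (by omega) with h1 | ⟨k, hk, h1⟩ | h1
        · exact Or.inl h1
        · exact Or.inr (Or.inl ⟨k, by omega, h1⟩)
        · exact Or.inr (Or.inl ⟨m, by omega, h, h1⟩)
      · exact Or.inr (Or.inr (S.claim1 T hT (m + 1) i hi h))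
  refine ⟨∑ i ∈ hfin.toFinset, C i + 1 + 1, fun G => ?_⟩
  obtain ⟨L, hL⟩ : ∃ L, G ⊆ Finset.range (L + 1) := by
    refine ⟨G.sup id, fun i hi => ?_⟩
    have : i ≤ G.sup id := Finset.le_sup (f := id) hi
    exact Finset.mem_range.2 (by omega)
  have hpt : ∀ i ∈ Finset.range L, C (i + 1) ≤ (if NN a e T 0 (i + 1) then C (i + 1) else 0) +
      (∑ k ∈ Finset.range L, if NN a e T (k + 1) (i + 1) then ((1 : ℚ) / 2) ^ kap (Nat.pair e k) else 0) + (1 / 2) ^ (i + 1) := by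
    intro i hi
    have hiL := Finset.mem_range.1 hi
    have n1 : 0 ≤ (if NN a e T 0 (i + 1) then C (i + 1) else 0) := by
      split_ifs
      · exact hC0 _
      · exact le_rfl
    have n2' : ∀ k ∈ Finset.range L, 0 ≤ (if NN a e T (k + 1) (i + 1) then ((1 : ℚ) / 2) ^ kap (Nat.pair e k) else 0) := by
      intro k _
      split_ifs
      · positivity
      · exact le_rfl
    have n2 := Finset.sum_nonneg n2'
    have n3 : (0 : ℚ) ≤ (1 / 2) ^ (i + 1) := by positivity
    rcases hdich (i + 1) i le_rfl with h | ⟨k, hk, h, h'⟩ | h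
    · rw [if_pos h]
      linarith
    · have := Finset.single_le_sum n2' (Finset.mem_range.2 (hk.trans hiL))
      rw [if_pos h] at this
      linarith
    · have : ((1 : ℚ) / 2) ^ kap (Nat.pair e i) ≤ (1 / 2) ^ (i + 1) := by
        apply pow_le_pow_of_le_one (by norm_num) (by norm_num)
        rw [kap_pair]; omega
      linarith
  have hzero : C 0 = 0 := by simp [hC, stageCost]
  calc ∑ i ∈ G, C i ≤ ∑ i ∈ Finset.range (L + 1), C i := Finset.sum_le_sum_of_subset_of_nonneg hL (fun i _ _ => hC0 i)
    _ = ∑ i ∈ Finset.range L, C (i + 1) := by rw [Finset.sum_range_succ', hzero, add_zero]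
    _ ≤ ∑ i ∈ Finset.range L, ((if NN a e T 0 (i + 1) then C (i + 1) else 0) +
      (∑ k ∈ Finset.range L, if NN a e T (k + 1) (i + 1) then ((1 : ℚ) / 2) ^ kap (Nat.pair e k) else 0) + (1 / 2) ^ (i + 1)) := Finset.sum_le_sum hpt
    _ = ∑ i ∈ Finset.range L, (if NN a e T 0 (i + 1) then C (i + 1) else 0) +
      ∑ i ∈ Finset.range L, (∑ k ∈ Finset.range L, if NN a e T (k + 1) (i + 1) then ((1 : ℚ) / 2) ^ kap (Nat.pair e k) else 0) + ∑ i ∈ Finset.range L, (1 / 2) ^ (i + 1) := by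
        rw [Finset.sum_add_distrib, Finset.sum_add_distrib]
    _ ≤ ∑ i ∈ hfin.toFinset, C i + 1 + 1 := by
      refine add_le_add (add_le_add ?_ ?_) (half_sum L)
      · rw [← Finset.sum_filter]
        have : ∑ i ∈ (Finset.range L).filter (fun i => NN a e T 0 (i + 1)), C (i + 1) =
            ∑ j ∈ ((Finset.range L).filter (fun i => NN a e T 0 (i + 1))).image (fun i => i + 1), C j := by
          rw [Finset.sum_image]
          intro x _ y _ h
          exact Nat.succ.inj h
        rw [this]
        refine Finset.sum_le_sum_of_subset_of_nonneg ?_ (fun i _ _ => hC0 i)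
        intro j hj
        simp only [Finset.mem_image, Finset.mem_filter] at hj
        obtain ⟨i, ⟨_, h⟩, rfl⟩ := hj
        exact hfin.mem_toFinset.2 h
      · rw [Finset.sum_comm]
        refine le_trans (Finset.sum_le_sum fun k _ => ?_) (half_sum L)
        rw [← Finset.sum_filter, Finset.sum_const, nsmul_eq_mul]
        have h1 : ((Finset.range L).filter (fun i => NN a e T (k + 1) (i + 1))).card ≤ 4 ^ (Nat.pair e (k + 1) + 2) := by
          have := S.claim2 T hT hTm (k + 1) (((Finset.range L).filter (fun i => NN a e T (k + 1) (i + 1))).image (fun i => i + 1)) (by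
            intro j hj
            simp only [Finset.mem_image, Finset.mem_filter] at hj
            obtain ⟨i, ⟨_, h⟩, rfl⟩ := hj
            exact h)
          rwa [Finset.card_image_of_injective _ (fun x y h => Nat.succ.inj h)] at this
        have h2 : ((((Finset.range L).filter (fun i => NN a e T (k + 1) (i + 1))).card : ℕ) : ℚ) ≤ 4 ^ (Nat.pair e (k + 1) + 2) := by
          exact_mod_cast h1
        refine (mul_le_mul_of_nonneg_right h2 (by positivity)).trans (le_of_eq ?_)
        rw [kap_pair]
        generalize Nat.pair e (k + 1) + 2 = q
        rw [pow_add, pow_mul, ← mul_assoc, ← mul_pow]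
        norm_num

theorem SU.obeys (S : SU A c F a f g b e bd) : Obeys A c := by
  classical
  let T : ℕ → ℕ := fun i => Nat.find (S.QQ_ex i)
  have hT : ∀ i, QQ e g i (T i) := fun i => Nat.find_spec (S.QQ_ex i)
  have hTm : Monotone T := fun i j hij => Nat.find_min' _ (QQ_anti hij (hT j))
  have hTc : Computable T := by
    have := T_computable S.QQ_ex
    convert this
  refine ⟨fun i y => As a (T i) y, ⟨?_, ?_⟩, S.total T hT hTm⟩
  · have h1 : Primrec (fun z : ℕ × ℕ => As a z.1 z.2) :=
      Primrec.option_isSome.comp (primrec_ev' Primrec.fst (Primrec.const a) Primrec.snd)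
    have h2 : Computable (fun z : ℕ × ℕ => (T z.1, z.2)) := Computable.pair (hTc.comp Computable.fst) Computable.snd
    have h3 := h1.to_comp.comp h2
    exact h3
  · intro y
    obtain ⟨s0, h0⟩ := Filter.eventually_atTop.1 (S.As_ev y)
    exact ⟨s0, fun i hi => h0 _ (hi.trans (hT i).1)⟩

end

theorem obeys_main (A : ℕ → Bool) (hA : CE A) (hAZ : TuringLE A Z) (c : ℕ → ℕ → ℚ) (hc : CostFunction c)
    (hben : Benign c) : Obeys A c := by
  obtain ⟨f0, hf0, hA0⟩ := hA
  obtain ⟨F, hF1, hF2, hF3⟩ := recIn_uniform Z _ hAZ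
  obtain ⟨hcc, hc0, hct, hcx⟩ := hc
  obtain ⟨bd, hbd, hben⟩ := hben
  obtain ⟨a, ha⟩ := code_part hf0
  have hu1 : Primrec (fun m : ℕ => m.unpair.1) := Primrec.fst.comp Primrec.unpair
  have hu21 : Primrec (fun m : ℕ => m.unpair.2.unpair.1) := Primrec.fst.comp (Primrec.unpair.comp (Primrec.snd.comp Primrec.unpair))
  have hu22 : Primrec (fun m : ℕ => m.unpair.2.unpair.2) := Primrec.snd.comp (Primrec.unpair.comp (Primrec.snd.comp Primrec.unpair))
  have hFc : Partrec (fun m : ℕ => F ((decode (α := List Bool) m.unpair.2.unpair.1).getD []) m.unpair.2.unpair.2) := by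
    have hτ : Primrec (fun m : ℕ => (decode (α := List Bool) m.unpair.2.unpair.1).getD []) :=
      Primrec.option_getD.comp (Primrec.decode.comp hu21) (Primrec.const [])
    have := hF1.comp hτ.to_comp hu22.to_comp
    exact this
  obtain ⟨f, hf⟩ := code_part (Partrec.nat_iff.1 hFc)
  have hgc : Computable (fun m : ℕ => (decide (((1:ℚ)/2) ^ kap m.unpair.1 ≤ c m.unpair.2.unpair.1 m.unpair.2.unpair.2)).toNat) := by
    have h1 : Computable (fun m : ℕ => c m.unpair.2.unpair.1 m.unpair.2.unpair.2) := by
      have := hcc.comp hu21.to_comp hu22.to_comp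
      exact this
    have h2 := computable_cmp _ _ h1 (primrec_kap.comp hu1).to_comp
    have h3 := primrec_toNat.to_comp.comp h2
    exact h3
  obtain ⟨g, hg⟩ := code_tot hgc
  have hbc : Computable (fun m : ℕ => bd (kap m)) := by
    have := hbd.comp primrec_kap.to_comp
    exact this
  obtain ⟨b, hb⟩ := code_tot hbc
  have S : SU A c F a f g b (Nat.pair (Nat.pair a f) (Nat.pair g b)) bd :=
    { he := rfl
      hA := by
        intro y
        rw [hA0, Part.dom_iff_mem]
        constructor
        · rintro ⟨v, hv⟩
          obtain ⟨s, hs⟩ := (ha y v).2 hv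
          exact ⟨s, by unfold As; rw [hs]; rfl⟩
        · rintro ⟨s, hs⟩
          obtain ⟨v, hv⟩ := Option.isSome_iff_exists.1 hs
          exact ⟨v, (ha y v).1 ⟨s, hv⟩⟩
      hF2 := hF2
      hF3 := by
        intro x
        refine hF3 x _ ?_
        unfold charFn
        refine Part.mem_some_iff.2 ?_
        cases A x <;> rfl
      hf := by
        intro p τ y v
        rw [hf]
        simp only [Nat.unpair_pair, encodek, Option.getD_some]
      hc0 := hc0
      hct := hct
      hcx := hcx
      hg := by
        intro p x t v
        rw [hg]
        simp only [Nat.unpair_pair]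
      hb := hb
      hben := hben }
  exact S.obeys

end Grb

end GreenbergHelpers

/-- Greenberg: There is a ML-random Δ⁰₂ set `Z` such that every
c.e. set below `Z` obeys every benign cost function. -/
theorem greenberg :
    ∃ Z : ℕ → Bool, MLRandom Z ∧ Delta02 Z ∧
      ∀ A : ℕ → Bool, CE A → TuringLE A Z →
        ∀ c : ℕ → ℕ → ℚ, CostFunction c → Benign c → Obeys A c := by
  exact ⟨Grb.Z, Grb.Z_random, Grb.Z_delta,
    fun A hA hAZ c hc hb => Grb.obeys_main A hA hAZ c hc hb⟩
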